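/- arXiv:2508.02818 — 18 statements merged into one kernel-verified Lean document; each statement's English description precedes it below -/
import Mathlib

section
/- Let C ≥ 5 be an integer. Suppose positive integers n, A, B, a₁, a₂, b₁, b₂ satisfy B ≤ A, 1 ≤ a₁ < a₂ ≤ C, 1 ≤ b₁ < b₂ ≤ C, b₂ < B, and n = A·B = (A + a₁)·(B − b₁) = (A + a₂)·(B − b₂). Then B ≤ A ≤ (1/4)·C·(C − 1)², i.e., 4·A ≤ C·(C − 1)². -/
/-- If `a * t ≤ s * b` then `4 * a * t` is at most the product of the sums `a + s` and `b + t`. -/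
theorem four_mul_le_of_mul_le_mul {a s b t P Q : ℤ} (ha : 0 ≤ a) (hs : 0 ≤ s) (hb : 0 ≤ b)
    (ht : 0 ≤ t) (hP : a + s ≤ P) (hQ : b + t ≤ Q) (h : a * t ≤ s * b) :
    4 * (a * t) ≤ P * Q := by
  have hP0 : 0 ≤ P := by linarith
  have hQ0 : 0 ≤ Q := by linarith
  have hat : 0 ≤ a * t := mul_nonneg ha ht
  have has : 4 * (a * s) ≤ P ^ 2 := by nlinarith [sq_nonneg (a - s)]
  have hbt : 4 * (b * t) ≤ Q ^ 2 := by nlinarith [sq_nonneg (b - t)]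
  have hprod : 4 * (a * s) * (4 * (b * t)) ≤ P ^ 2 * Q ^ 2 :=
    mul_le_mul has hbt (by positivity) (by positivity)
  have hsq : (a * t) * (a * t) ≤ (a * t) * (s * b) := mul_le_mul_of_nonneg_left h hat
  refine (abs_le_of_sq_le_sq' ?_ (mul_nonneg hP0 hQ0)).2
  linarith [show (4 * (a * t)) ^ 2 = 16 * ((a * t) * (a * t)) by ring,
    show 4 * (a * s) * (4 * (b * t)) = 16 * ((a * t) * (s * b)) by ring,
    show (P * Q) ^ 2 = P ^ 2 * Q ^ 2 by ring]

/-- Numbers with three close factorizations: if `n = A·B = (A+a₁)(B−b₁) = (A+a₂)(B−b₂)`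
with `B ≤ A`, `1 ≤ a₁ < a₂ ≤ C`, `1 ≤ b₁ < b₂ ≤ C`, `b₂ < B`, and `C ≥ 5`,
then `4·A ≤ C·(C−1)²`. -/
theorem three_close_factorizations_bound
    (C n A B a₁ a₂ b₁ b₂ : ℤ)
    (hC : 5 ≤ C)
    (hApos : 0 < A) (hBpos : 0 < B) (hBA : B ≤ A)
    (ha₁ : 1 ≤ a₁) (ha12 : a₁ < a₂) (ha₂C : a₂ ≤ C)
    (hb₁ : 1 ≤ b₁) (hb12 : b₁ < b₂) (hb₂C : b₂ ≤ C)
    (hb₂B : b₂ < B)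
    (hn : n = A * B)
    (h1 : n = (A + a₁) * (B - b₁))
    (h2 : n = (A + a₂) * (B - b₂)) :
    4 * A ≤ C * (C - 1) ^ 2 := by
  have e₁ : a₁ * B - b₁ * A = a₁ * b₁ := by linarith
  have e₂ : a₂ * B - b₂ * A = a₂ * b₂ := by linarith
  obtain ⟨D, hD⟩ : ∃ D, D = a₂ * b₁ - a₁ * b₂ := ⟨_, rfl⟩
  have hAD : A * D = a₂ * (a₁ * (b₂ - b₁)) := by
    rw [hD]; linear_combination a₁ * e₂ - a₂ * e₁
  have hpos : 0 < a₁ * (b₂ - b₁) := mul_pos (by linarith) (by linarith)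
  have hDpos : 0 < D :=
    pos_of_mul_pos_right (hAD ▸ mul_pos (by linarith) hpos : 0 < A * D) hApos.le
  have hle : a₁ * (b₂ - b₁) ≤ (a₂ - a₁) * b₁ := by linarith
  have key {P Q : ℤ} (hP : a₂ ≤ P) (hQ : b₂ ≤ Q) : 4 * (a₁ * (b₂ - b₁)) ≤ P * Q :=
    four_mul_le_of_mul_le_mul (by linarith) (by linarith) (by linarith) (by linarith)
      (by linarith) (by linarith) hle
  -- It suffices to bound `4 * a₁ * (b₂ - b₁)` by `D * (C - 1) ^ 2`.
  have reduce (h : 4 * (a₁ * (b₂ - b₁)) ≤ D * (C - 1) ^ 2) : 4 * A ≤ C * (C - 1) ^ 2 := by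
    refine le_of_mul_le_mul_right ?_ hDpos
    calc 4 * A * D = a₂ * (4 * (a₁ * (b₂ - b₁))) := by linear_combination 4 * hAD
      _ ≤ C * (D * (C - 1) ^ 2) := mul_le_mul ha₂C h (by linarith) (by linarith)
      _ = C * (C - 1) ^ 2 * D := by ring
  rcases (show 1 ≤ D from hDpos).eq_or_lt with hD1 | hD2
  · rw [← hD1, mul_one] at hAD
    rcases ha₂C.lt_or_eq with ha | rfl
    · have ha' : a₂ ≤ C - 1 := by linarith
      calc 4 * A = a₂ * (4 * (a₁ * (b₂ - b₁))) := by linear_combination 4 * hAD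
        _ ≤ (C - 1) * ((C - 1) * C) :=
          mul_le_mul ha' (key ha' hb₂C) (by linarith) (by linarith)
        _ = C * (C - 1) ^ 2 := by ring
    · apply reduce
      rw [← hD1, one_mul]
      rcases (show b₂ = a₂ ∨ b₂ = a₂ - 1 ∨ b₂ ≤ a₂ - 2 by lia) with rfl | rfl | hb
      · have : b₂ ∣ 1 := ⟨b₁ - a₁, by linear_combination hD1.trans hD⟩
        linarith [Int.le_of_dvd one_pos this]
      · have hdvd : a₂ ∣ a₁ - 1 := ⟨a₁ - b₁, by linear_combination -(hD1.trans hD)⟩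
        have h0 := Int.eq_zero_of_dvd_of_nonneg_of_lt (by linarith) (by linarith) hdvd
        have ha1 : a₁ = 1 := by linarith
        rw [ha1]
        nlinarith [sq_nonneg (a₂ - 3)]
      · linarith [key le_rfl hb]
  · apply reduce
    have : 2 * (C - 1) ^ 2 ≤ D * (C - 1) ^ 2 :=
      mul_le_mul_of_nonneg_right hD2 (sq_nonneg _)
    nlinarith [key ha₂C hb₂C]
end

section
/- There exists a constant c > 0 such that the following holds. Whenever n, A, B, a₁, a₂, a₃, b₁, b₂, b₃ are positive integers satisfying B ≤ A, a₁ < a₂ < a₃, b₁ < b₂ < b₃, b₃ < B, and n = A·B = (A + a₁)·(B − b₁) = (A + a₂)·(B − b₂) = (A + a₃)·(B − b₃), one has (as real numbers) A / a₃³ ≤ (6 + √6) / (9·(2 + √6)²) + c / n^(1/3). -/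
/-- A weighted bound for the normalized areas spanned by four points on a parabola whose
abscissae have consecutive gaps `u`, `v`, `w`. -/
lemma weighted_gap_products_le {u v w : ℝ} (hu : 0 ≤ u) (hv : 0 ≤ v) (hw : 0 ≤ w) :
    10 * (u * v * (u + v)) + 28 * (v * w * (v + w)) + 18 * (u * (v + w) * (u + v + w)) ≤
      7 * (u + v + w) ^ 3 := by
  have hexp : 7 * (u + v + w) ^ 3 - (10 * (u * v * (u + v)) + 28 * (v * w * (v + w)) +
      18 * (u * (v + w) * (u + v + w))) =
      7 * (u + w + v) * (u + w - v) ^ 2 + u * w * (20 * v - 18 * (u + w)) := by ring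
  have huw : 4 * (u * w) ≤ (u + w) ^ 2 := by linarith [sq_nonneg (u - w)]
  have huw0 : 0 ≤ u * w := mul_nonneg hu hw
  have hm : 0 ≤ u + w := add_nonneg hu hw
  generalize u + w = m at *
  generalize u * w = g at *
  suffices 0 ≤ 7 * (m + v) * (m - v) ^ 2 + g * (20 * v - 18 * m) by linarith
  rcases le_total (18 * m) (20 * v) with h | h
  · have := mul_nonneg huw0 (sub_nonneg.2 h)
    positivity
  · have h1 : 0 ≤ (m ^ 2 - 4 * g) * (18 * m - 20 * v) :=
      mul_nonneg (sub_nonneg.2 huw) (sub_nonneg.2 h)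
    have h2 : 0 ≤ 28 * v ^ 3 - 28 * m * v ^ 2 - 8 * m ^ 2 * v + 10 * m ^ 3 := by
      nlinarith [mul_nonneg hv (sq_nonneg (v - 63 / 80 * m)),
        mul_nonneg hm (sq_nonneg (v - 63 / 80 * m)), pow_nonneg hm 3,
        mul_nonneg hv (sq_nonneg m)]
    linarith

lemma lt_of_mul_one_sub_lt {x y : ℝ} (hy : y ≤ 1 / 2) (h : y * (1 - y) < x * (1 - x)) :
    y < x := by
  nlinarith

/-- The extremal configuration of gaps `u`, `1 - u - w`, `w`: the normalized areas cannot
all exceed the multiples `2, 1, 4, 3` of a number larger than `√6 / 2 - 7 / 6`. -/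
lemma extremal_normalized {u w k : ℝ} (huw : u + w ≤ 1)
    (hpq : 3 * k ≤ (1 - u - w) * (u + w - 2 * (u * w)))
    (hr : 4 * k ≤ u * (1 - u)) (ht : 3 * k ≤ w * (1 - w)) :
    k ≤ √6 / 2 - 7 / 6 := by
  by_contra! hk
  have hs : √6 ^ 2 = 6 := Real.sq_sqrt (by norm_num)
  have hs0 : 0 ≤ √6 := Real.sqrt_nonneg 6
  have hs1 : 2.449 < √6 := by nlinarith
  have hs2 : √6 < 2.4495 := by nlinarith
  have hu : 2 - 2 * √6 / 3 < u := lt_of_mul_one_sub_lt (by linarith) (by nlinarith)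
  have hw : √6 / 2 - 1 < w := lt_of_mul_one_sub_lt (by linarith) (by nlinarith)
  obtain ⟨a, rfl⟩ : ∃ a, u = 2 - 2 * √6 / 3 + a := ⟨u - (2 - 2 * √6 / 3), by ring⟩
  obtain ⟨b, rfl⟩ : ∃ b, w = √6 / 2 - 1 + b := ⟨w - (√6 / 2 - 1), by ring⟩
  have ha : 0 < a := by linarith
  have hb : 0 < b := by linarith
  generalize √6 = s at *
  have h1 : 0 ≤ a * b * (s / 6 - a - b) := mul_nonneg (by positivity) (by linarith)
  have h2 : 0 ≤ (a + b) * (a * (3 - s) + b * (4 * s / 3 - 3)) :=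
    mul_nonneg (by positivity)
      (add_nonneg (mul_nonneg ha.le (by linarith)) (mul_nonneg hb.le (by linarith)))
  have h3 : 0 ≤ a * (10 - 4 * s) := mul_nonneg ha.le (by linarith)
  have h4 : 0 ≤ b * (23 / 3 - 3 * s) := mul_nonneg hb.le (by linarith)
  have key : (1 - (2 - 2 * s / 3 + a) - (s / 2 - 1 + b)) *
      (2 - 2 * s / 3 + a + (s / 2 - 1 + b) - 2 * ((2 - 2 * s / 3 + a) * (s / 2 - 1 + b))) =
      3 * (s / 2 - 7 / 6) - a * (10 - 4 * s) - b * (23 / 3 - 3 * s)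
        - 2 * (a * b * (s / 6 - a - b)) -
        (a + b) * (a * (3 - s) + b * (4 * s / 3 - 3)) := by
    linear_combination (s / 9 - 7 / 12 - 5 * a / 6 - 4 * b / 9) * hs
  linarith

/-- The extremal bound for gaps `u`, `v`, `w`, in homogeneous form. -/
lemma extremal_gap_products {u v w l : ℝ} (hu : 0 < u) (hv : 0 < v) (hw : 0 < w)
    (hl : 0 < l)
    (hp : 2 ≤ l * (u * v * (u + v))) (hq : 1 ≤ l * (v * w * (v + w)))
    (hr : 4 ≤ l * (u * (v + w) * (u + v + w))) (ht : 3 ≤ l * ((u + v) * w * (u + v + w))) :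
    1 ≤ (√6 / 2 - 7 / 6) * (l * (u + v + w) ^ 3) := by
  have hs : 0 < u + v + w := by positivity
  have hL : 0 < l * (u + v + w) ^ 3 := by positivity
  rw [← div_le_iff₀ hL]
  apply extremal_normalized (u := u / (u + v + w)) (w := w / (u + v + w))
  · rw [← add_div, div_le_one hs]; linarith
  · have : (1 - u / (u + v + w) - w / (u + v + w)) * (u / (u + v + w) + w / (u + v + w) -
        2 * (u / (u + v + w) * (w / (u + v + w)))) =
        (l * (u * v * (u + v)) + l * (v * w * (v + w))) / (l * (u + v + w) ^ 3) := by
      field_simp; ring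
    rw [this, mul_one_div]
    gcongr
    linarith
  · have : u / (u + v + w) * (1 - u / (u + v + w)) =
        l * (u * (v + w) * (u + v + w)) / (l * (u + v + w) ^ 3) := by
      field_simp; ring
    rw [this, mul_one_div]
    gcongr
  · have : w / (u + v + w) * (1 - w / (u + v + w)) =
        l * ((u + v) * w * (u + v + w)) / (l * (u + v + w) ^ 3) := by
      field_simp; ring
    rw [this, mul_one_div]
    gcongr

/-- Four lattice points on a hyperbola: `p, q, r, t` are the doubled areas of the triangles they
span, and `E, F` measure the offsets of the abscissae and ordinates from a common parabola. -/
lemma exists_area_data {A B a₁ a₂ a₃ b₁ b₂ b₃ : ℤ} (hA : 0 < A) (hB : 0 < B)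
    (h₁ : 0 < a₁) (h₁₂ : a₁ < a₂) (h₂₃ : a₂ < a₃)
    (e₁ : (A + a₁) * b₁ = a₁ * B) (e₂ : (A + a₂) * b₂ = a₂ * B) (e₃ : (A + a₃) * b₃ = a₃ * B) :
    ∃ p q r t E F : ℤ, 0 < p ∧ 0 < q ∧ p + t = q + r ∧ p < r ∧ (p = q → A ≤ a₃ ^ 2) ∧
      p * a₃ = r * a₂ - t * a₁ ∧ p * b₃ = r * b₂ - t * b₁ ∧
      E = r * a₂ * (a₃ - a₂) - t * a₁ * (a₃ - a₁) ∧
      F = -(r * b₂ * (b₃ - b₂) - t * b₁ * (b₃ - b₁)) ∧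
      0 < F ∧ E * F = p * q * r * t ∧
      (A + a₁) * (A + a₂) * (A + a₃) * F = A * B ^ 2 * E ∧
      A ^ 2 * p ≤ B * (a₁ * (a₂ - a₁) * a₂) ∧
      A ^ 2 * q ≤ B * ((a₂ - a₁) * (a₃ - a₂) * (a₃ - a₁)) ∧
      A ^ 2 * r ≤ B * (a₁ * (a₃ - a₁) * a₃) ∧
      A ^ 2 * t ≤ B * (a₂ * (a₃ - a₂) * a₃) := by
  obtain ⟨v, rfl⟩ : ∃ v, a₂ = a₁ + v := ⟨a₂ - a₁, by ring⟩
  obtain ⟨w, rfl⟩ : ∃ w, a₃ = a₁ + v + w := ⟨a₃ - (a₁ + v), by ring⟩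
  have hv : 0 < v := by linarith
  have hw : 0 < w := by linarith
  obtain ⟨p, hp⟩ : ∃ p, p = (a₁ + v) * b₁ - a₁ * b₂ := ⟨_, rfl⟩
  obtain ⟨r, hr⟩ : ∃ r, r = (a₁ + v + w) * b₁ - a₁ * b₃ := ⟨_, rfl⟩
  obtain ⟨t, ht⟩ : ∃ t, t = (a₁ + v + w) * b₂ - (a₁ + v) * b₃ := ⟨_, rfl⟩
  obtain ⟨q, hq⟩ : ∃ q, q = p + t - r := ⟨_, rfl⟩
  obtain ⟨x, hx⟩ : ∃ x, x = A + a₁ := ⟨_, rfl⟩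
  obtain ⟨y, hy⟩ : ∃ y, y = A + (a₁ + v) := ⟨_, rfl⟩
  obtain ⟨z, hz⟩ : ∃ z, z = A + (a₁ + v + w) := ⟨_, rfl⟩
  obtain ⟨E, hE⟩ : ∃ E, E = r * (a₁ + v) * w - t * a₁ * (v + w) := ⟨_, rfl⟩
  obtain ⟨F, hF⟩ : ∃ F, F = t * b₁ * (b₃ - b₁) - r * b₂ * (b₃ - b₂) := ⟨_, rfl⟩
  rw [← hx] at e₁
  rw [← hy] at e₂
  rw [← hz] at e₃
  have hxA : A ≤ x := by linarith
  have hyA : A ≤ y := by linarith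
  have hzA : A ≤ z := by linarith
  have hx0 : 0 < x := by linarith
  have hy0 : 0 < y := by linarith
  have hz0 : 0 < z := by linarith
  have hX : 0 < x * y * z := by positivity
  have hP : x * y * p = B * (a₁ * v * (a₁ + v)) := by
    rw [hp]
    linear_combination (a₁ + v) * y * e₁ - a₁ * x * e₂ + a₁ * (a₁ + v) * B * (hy - hx)
  have hR : x * z * r = B * (a₁ * (v + w) * (a₁ + v + w)) := by
    rw [hr]
    linear_combination (a₁ + v + w) * z * e₁ - a₁ * x * e₃ +
      a₁ * (a₁ + v + w) * B * (hz - hx)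
  have hT : y * z * t = B * ((a₁ + v) * w * (a₁ + v + w)) := by
    rw [ht]
    linear_combination (a₁ + v + w) * z * e₂ - (a₁ + v) * y * e₃ +
      (a₁ + v) * (a₁ + v + w) * B * (hz - hy)
  have hQ : x * y * z * q = A * B * (v * w * (v + w)) := by
    have : x * y * z * q = z * (x * y * p) + x * (y * z * t) - y * (x * z * r) := by
      rw [hq]; ring
    rw [this, hP, hT, hR, hx, hy, hz]
    ring
  have hXE : x * y * z * E =
      B * (a₁ * v * w * (a₁ + v) * (v + w) * (a₁ + v + w)) := by
    have : x * y * z * E = y * (x * z * r) * ((a₁ + v) * w) - x * (y * z * t) * (a₁ * (v + w)) := by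
      rw [hE]; ring
    rw [this, hT, hR, hx, hy]
    ring
  have hb₁₃ : x * z * (b₃ - b₁) = A * B * (v + w) := by
    have : x * z * (b₃ - b₁) = x * (z * b₃) - z * (x * b₁) := by ring
    rw [this, e₁, e₃, hx, hz]
    ring
  have hb₂₃ : y * z * (b₃ - b₂) = A * B * w := by
    have : y * z * (b₃ - b₂) = y * (z * b₃) - z * (y * b₂) := by ring
    rw [this, e₂, e₃, hy, hz]
    ring
  have hXF : x * y * z * F = A * B ^ 2 * E := by
    apply mul_left_cancel₀ hX.ne'
    have : x * y * z * (x * y * z * F) =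
        y * (y * z * t) * (x * b₁) * (x * z * (b₃ - b₁)) -
          x * (x * z * r) * (y * b₂) * (y * z * (b₃ - b₂)) := by
      rw [hF]; ring
    rw [this, hT, e₁, hb₁₃, hR, e₂, hb₂₃]
    linear_combination (-A * B ^ 2) * hXE +
      A * B ^ 3 * (a₁ * w * (a₁ + v) * (v + w) * (a₁ + v + w)) * (hy - hx)
  have hEF : E * F = p * q * r * t := by
    apply mul_left_cancel₀ (pow_pos hX 3).ne'
    have h1 : (x * y * z) ^ 3 * (E * F) = (x * y * z) ^ 2 * E * (x * y * z * F) := by ring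
    have h2 : (x * y * z) ^ 2 * E * (A * B ^ 2 * E) = A * B ^ 2 * (x * y * z * E) ^ 2 := by ring
    have h3 : (x * y * z) ^ 3 * (p * q * r * t) =
        (x * y * p) * (x * y * z * q) * (x * z * r) * (y * z * t) := by ring
    rw [h1, hXF, h2, hXE, h3, hP, hQ, hR, hT]
    ring
  have hp0 : 0 < p := (mul_pos_iff_of_pos_left (mul_pos hx0 hy0)).1 (hP ▸ by positivity)
  have hr0 : 0 < r := (mul_pos_iff_of_pos_left (mul_pos hx0 hz0)).1 (hR ▸ by positivity)
  have ht0 : 0 < t := (mul_pos_iff_of_pos_left (mul_pos hy0 hz0)).1 (hT ▸ by positivity)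
  have hq0 : 0 < q := (mul_pos_iff_of_pos_left hX).1 (hQ ▸ by positivity)
  have hE0 : 0 < E := (mul_pos_iff_of_pos_left hX).1 (hXE ▸ by positivity)
  have hF0 : 0 < F := (mul_pos_iff_of_pos_left hX).1 (hXF ▸ by positivity)
  have hlin : p * (a₁ + v + w) = r * (a₁ + v) - t * a₁ := by
    rw [hp, hr, ht]; ring
  refine ⟨p, q, r, t, E, F, hp0, hq0, by rw [hq]; ring, ?_, ?_, hlin, ?_, ?_, ?_, hF0, hEF,
    ?_, ?_, ?_, ?_, ?_⟩
  · have : 0 < (a₁ + v) * (r - p) := by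
      have : (a₁ + v) * (r - p) = t * a₁ + p * w := by linear_combination -hlin
      rw [this]; positivity
    linarith [(mul_pos_iff_of_pos_left (by positivity : 0 < a₁ + v)).1 this]
  · intro hpq
    have h : A * (w - a₁) = a₁ * (a₁ + v) := by
      apply mul_left_cancel₀ (by positivity : B * v * (a₁ + v + w) ≠ 0)
      rw [← hpq] at hQ
      linear_combination z * hP - hQ + B * (a₁ * v * (a₁ + v)) * hz
    have h1 : 0 < w - a₁ := (mul_pos_iff_of_pos_left hA).1 (h ▸ by positivity)
    calc A ≤ A * (w - a₁) := le_mul_of_one_le_right hA.le h1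
      _ = a₁ * (a₁ + v) := h
      _ ≤ (a₁ + v + w) * (a₁ + v + w) := by gcongr; linarith
      _ = _ := by ring
  · rw [hp, hr, ht]; ring
  · rw [hE]; ring
  · rw [hF]; ring
  · rw [← hx, ← hy, ← hz]; exact hXF
  · calc A ^ 2 * p ≤ x * y * p := by rw [sq]; gcongr
      _ = _ := by rw [hP]; ring
  · apply le_of_mul_le_mul_left _ hA
    calc A * (A ^ 2 * q) = A * A * A * q := by ring
      _ ≤ x * y * z * q := by gcongr
      _ = _ := by rw [hQ]; ring
  · calc A ^ 2 * r ≤ x * z * r := by rw [sq]; gcongr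
      _ = _ := by rw [hR]; ring
  · calc A ^ 2 * t ≤ y * z * t := by rw [sq]; gcongr
      _ = _ := by rw [hT]; ring

/-- The area patterns `(p, q, r, t)` that the weighted area bound does not exclude by itself. -/
def IsExceptionalPattern (p q r t : ℤ) : Prop :=
  (p = 2 ∧ q = 1 ∧ (r = 3 ∧ t = 2 ∨ r = 4 ∧ t = 3 ∨ r = 5 ∧ t = 4)) ∨
    (p = 3 ∧ q = 1 ∧ r = 4 ∧ t = 2)

lemma IsExceptionalPattern.two_dvd {p q r t a₁ a₂ a₃ : ℤ} (h : IsExceptionalPattern p q r t)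
    (ha : p * a₃ = r * a₂ - t * a₁) :
    2 ∣ r * a₂ * (a₃ - a₂) - t * a₁ * (a₃ - a₁) := by
  obtain ⟨rfl, rfl, ⟨rfl, rfl⟩ | ⟨rfl, rfl⟩ | ⟨rfl, rfl⟩⟩ | ⟨rfl, rfl, rfl, rfl⟩ := h
  · obtain ⟨k, rfl⟩ : 2 ∣ a₂ := by omega
    exact ⟨3 * k * (a₃ - 2 * k) - a₁ * (a₃ - a₁), by ring⟩
  · obtain ⟨k, rfl⟩ : 2 ∣ a₁ := by omega
    exact ⟨2 * a₂ * (a₃ - a₂) - 3 * k * (a₃ - 2 * k), by ring⟩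
  · obtain ⟨k, rfl⟩ : 2 ∣ a₂ := by omega
    exact ⟨5 * k * (a₃ - 2 * k) - 2 * a₁ * (a₃ - a₁), by ring⟩
  · exact ⟨2 * a₂ * (a₃ - a₂) - a₁ * (a₃ - a₁), by ring⟩

lemma IsExceptionalPattern.two_dvd_of_swap {p q r t a₁ a₂ a₃ : ℤ}
    (h : IsExceptionalPattern q p t r) (ha : p * a₃ = r * a₂ - t * a₁) :
    2 ∣ r * a₂ * (a₃ - a₂) - t * a₁ * (a₃ - a₁) := by
  obtain ⟨rfl, rfl, ⟨rfl, rfl⟩ | ⟨rfl, rfl⟩ | ⟨rfl, rfl⟩⟩ | ⟨rfl, rfl, rfl, rfl⟩ := h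
  · obtain rfl : a₃ = 2 * a₂ - 3 * a₁ := by omega
    exact ⟨a₂ * (a₂ - 3 * a₁) - 3 * a₁ * (a₂ - 2 * a₁), by ring⟩
  · obtain rfl : a₃ = 3 * a₂ - 4 * a₁ := by omega
    exact ⟨3 * a₂ * (a₂ - 2 * a₁) - 2 * a₁ * (3 * a₂ - 5 * a₁), by ring⟩
  · obtain rfl : a₃ = 4 * a₂ - 5 * a₁ := by omega
    exact ⟨2 * a₂ * (3 * a₂ - 5 * a₁) - 5 * a₁ * (2 * a₂ - 3 * a₁), by ring⟩
  · exact ⟨a₂ * (a₃ - a₂) - 2 * a₁ * (a₃ - a₁), by ring⟩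

/-- Two even factors of `12`, `24` or `40` differ by a definite ratio. -/
lemma even_factor_ratio {E F m : ℤ} (hE : 2 ∣ E) (hF : 2 ∣ F) (hF0 : 0 < F) (hFE : F ≤ E)
    (h : E * F = m) :
    (m = 24 → 3 * F ≤ 2 * E) ∧ (m = 12 ∨ m = 40 → 5 * F ≤ 2 * E) := by
  obtain ⟨k, rfl⟩ := hE
  obtain ⟨l, rfl⟩ := hF
  have hl : m ≤ 40 → l ≤ 3 := fun hm => by nlinarith
  constructor
  · intro hm
    have := hl (by omega)
    have : 0 < l := by omega
    interval_cases l <;> omega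
  · intro hm
    have := hl (by omega)
    have : 0 < l := by omega
    interval_cases l <;> omega

/-- The dichotomy for the areas: either they are large, or one of finitely many patterns
occurs. -/
lemma large_or_exceptional {p q r t : ℤ} (hq : 0 < q) (hqp : q < p) (hs : p + t = q + r)
    (hpr : p < r) : 148 ≤ 10 * p + 28 * q + 18 * r ∨ IsExceptionalPattern p q r t := by
  unfold IsExceptionalPattern
  omega

lemma ratio_le_of_area_bound {A B a κ C K : ℝ} (hA : 0 < A) (hB : 0 < B) (ha : 0 < a)
    (hK : 0 ≤ K) (harea : A ^ 2 ≤ κ * (B * a ^ 3))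
    (hskew : C * (A * B ^ 2) ≤ (A + a) ^ 3) (hC : κ ^ 2 ≤ C * K ^ 2) :
    A / a ^ 3 ≤ K * (1 + a / A) ^ 2 := by
  have h1 : A / a ^ 3 ≤ κ * (B / A) := by
    rw [div_le_iff₀ (by positivity), show κ * (B / A) * a ^ 3 = κ * (B * a ^ 3) / A by ring,
      le_div_iff₀ hA]
    linarith
  have h2 : (κ * (B / A)) ^ 2 ≤ (K * (1 + a / A) ^ 2) ^ 2 := by
    have h3 : C * (B / A) ^ 2 ≤ (1 + a / A) ^ 3 := by
      have e1 : C * (B / A) ^ 2 = C * (A * B ^ 2) / A ^ 3 := by field_simp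
      have e2 : (1 + a / A) ^ 3 = (A + a) ^ 3 / A ^ 3 := by field_simp
      rw [e1, e2]
      gcongr
    have h4 : (1 : ℝ) ≤ 1 + a / A := by linarith [div_pos ha hA]
    calc (κ * (B / A)) ^ 2 = κ ^ 2 * (B / A) ^ 2 := by ring
      _ ≤ C * K ^ 2 * (B / A) ^ 2 := by gcongr
      _ = K ^ 2 * (C * (B / A) ^ 2) := by ring
      _ ≤ K ^ 2 * (1 + a / A) ^ 3 := by gcongr
      _ ≤ K ^ 2 * (1 + a / A) ^ 4 := by gcongr; norm_num
      _ = _ := by ring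
  exact h1.trans (abs_le_of_sq_le_sq' h2 (by positivity)).2

/-- The ratio bound, given the bounds for the areas in the orientation `q < p`. -/
lemma ratio_le_of_areas {A B u v w : ℝ} {p q r t : ℤ} {K : ℝ} (hK : K = 1 - 7 * √6 / 18)
    (hA : 0 < A) (hB : 0 < B) (hBA : B ≤ A) (hu : 0 < u) (hv : 0 < v) (hw : 0 < w)
    (hq : 0 < q) (hqp : q < p) (hs : p + t = q + r) (hpr : p < r)
    (hp' : A ^ 2 * p ≤ B * (u * v * (u + v))) (hq' : A ^ 2 * q ≤ B * (v * w * (v + w)))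
    (hr' : A ^ 2 * r ≤ B * (u * (v + w) * (u + v + w)))
    (ht' : A ^ 2 * t ≤ B * ((u + v) * w * (u + v + w)))
    (hskew : IsExceptionalPattern p q r t →
      (p * q * r * t = 24 → 3 * (A * B ^ 2) ≤ 2 * (A + (u + v + w)) ^ 3) ∧
      (p * q * r * t = 12 ∨ p * q * r * t = 40 →
        5 * (A * B ^ 2) ≤ 2 * (A + (u + v + w)) ^ 3)) :
    A / (u + v + w) ^ 3 ≤ K * (1 + (u + v + w) / A) ^ 2 := by
  have hs6 : √6 ^ 2 = 6 := Real.sq_sqrt (by norm_num)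
  have hs0 : 0 ≤ √6 := Real.sqrt_nonneg 6
  have hs1 : 2.449 < √6 := by nlinarith
  have hs2 : √6 < 2.4495 := by nlinarith
  have hK1 : 0.0474 < K := by rw [hK]; nlinarith
  have hKsq : 0.0474 ^ 2 ≤ K ^ 2 := by gcongr
  have ha : 0 < u + v + w := by positivity
  have hweight : A ^ 2 * (10 * p + 28 * q + 18 * r) ≤ 7 * (B * (u + v + w) ^ 3) := by
    have := mul_le_mul_of_nonneg_left (weighted_gap_products_le hu.le hv.le hw.le) hB.le
    linarith
  have key : ∀ m C : ℝ, 0 < m → m ≤ 10 * p + 28 * q + 18 * r →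
      C * (A * B ^ 2) ≤ (A + (u + v + w)) ^ 3 → (7 / m) ^ 2 ≤ C * K ^ 2 →
      A / (u + v + w) ^ 3 ≤ K * (1 + (u + v + w) / A) ^ 2 := by
    intro m C hm hmle hC hCK
    refine ratio_le_of_area_bound hA hB ha (by linarith) ?_ hC hCK
    rw [div_mul_eq_mul_div, le_div_iff₀ hm]
    exact (mul_le_mul_of_nonneg_left hmle (sq_nonneg A)).trans hweight
  rcases large_or_exceptional hq hqp hs hpr with h | h
  · refine key 148 1 (by norm_num) (by exact_mod_cast h) ?_ (by linarith)
    calc 1 * (A * B ^ 2) ≤ 1 * (A * A ^ 2) := by gcongr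
      _ = A ^ 3 := by ring
      _ ≤ _ := by gcongr; linarith
  have hsk := hskew h
  obtain ⟨rfl, rfl, ⟨rfl, rfl⟩ | ⟨rfl, rfl⟩ | ⟨rfl, rfl⟩⟩ | ⟨rfl, rfl, rfl, rfl⟩ := h
  · have := hsk.2 (by norm_num)
    exact key 102 (5 / 2) (by norm_num) (by norm_num) (by linarith) (by linarith)
  · have := hsk.1 (by norm_num)
    refine ratio_le_of_area_bound (κ := √6 / 2 - 7 / 6) (C := 3 / 2) hA hB ha
      (by linarith) ?_ (by linarith) ?_
    · have := extremal_gap_products hu hv hw (l := B / A ^ 2) (by positivity)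
        (by rw [div_mul_eq_mul_div, le_div_iff₀ (by positivity)]; push_cast at hp'; linarith)
        (by rw [div_mul_eq_mul_div, le_div_iff₀ (by positivity)]; push_cast at hq'; linarith)
        (by rw [div_mul_eq_mul_div, le_div_iff₀ (by positivity)]; push_cast at hr'; linarith)
        (by rw [div_mul_eq_mul_div, le_div_iff₀ (by positivity)]; push_cast at ht'; linarith)
      rw [div_mul_eq_mul_div, mul_div_assoc', le_div_iff₀ (by positivity)] at this
      linarith
    · rw [hK]
      nlinarith
  · have := hsk.2 (by norm_num)
    exact key 102 (5 / 2) (by norm_num) (by norm_num) (by linarith) (by linarith)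
  · have := hsk.1 (by norm_num)
    exact key 130 (3 / 2) (by norm_num) (by norm_num) (by linarith) (by linarith)

lemma skew_bound {A B a₁ a₂ a₃ E F m : ℤ} (hA : 0 < A) (hB : 0 < B) (hBA : B ≤ A)
    (h₁ : 0 < a₁) (h₁₂ : a₁ < a₂) (h₂₃ : a₂ < a₃) (hE : 2 ∣ E) (hF : 2 ∣ F) (hF0 : 0 < F)
    (hEF : E * F = m) (hX : (A + a₁) * (A + a₂) * (A + a₃) * F = A * B ^ 2 * E) :
    (m = 24 → 3 * (A * B ^ 2) ≤ 2 * (A + a₃) ^ 3) ∧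
      (m = 12 ∨ m = 40 → 5 * (A * B ^ 2) ≤ 2 * (A + a₃) ^ 3) := by
  have hle : (A + a₁) * (A + a₂) * (A + a₃) ≤ (A + a₃) ^ 3 := by
    have h1 : A + a₁ ≤ A + a₃ := by linarith
    have h2 : A + a₂ ≤ A + a₃ := by linarith
    have h3 : 0 < A + a₂ := by linarith
    have h4 : 0 < A + a₃ := by linarith
    calc (A + a₁) * (A + a₂) * (A + a₃) ≤ (A + a₃) * (A + a₃) * (A + a₃) := by
          gcongr
      _ = _ := by ring
  have hAB : 0 < A * B ^ 2 := by positivity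
  have hge : A * B ^ 2 ≤ (A + a₁) * (A + a₂) * (A + a₃) := by
    calc A * B ^ 2 ≤ A * A ^ 2 := by gcongr
      _ = A * A * A := by ring
      _ ≤ _ := mul_le_mul (mul_le_mul (by linarith) (by linarith) hA.le (by linarith))
        (by linarith) hA.le (mul_nonneg (by linarith) (by linarith))
  have hFE : F ≤ E := by
    refine le_of_mul_le_mul_left ?_ hAB
    rw [← hX]
    gcongr
  have hr := even_factor_ratio hE hF hF0 hFE hEF
  have hcancel : ∀ k : ℤ, k * F ≤ 2 * E → k * (A * B ^ 2) ≤ 2 * (A + a₃) ^ 3 := by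
    intro k hk
    have : k * (A * B ^ 2) ≤ 2 * ((A + a₁) * (A + a₂) * (A + a₃)) := by
      refine le_of_mul_le_mul_right ?_ hF0
      have := mul_le_mul_of_nonneg_left hk hAB.le
      linarith
    linarith
  exact ⟨fun h => hcancel 3 (hr.1 h), fun h => hcancel 5 (hr.2 h)⟩

/-- Up to the case `A ≤ a₃ ^ 2`, the ratio `A / a₃ ^ 3` exceeds the limiting constant by at most
a factor depending on `a₃ / A`. -/
lemma le_sq_or_ratio_le {A B a₁ a₂ a₃ b₁ b₂ b₃ : ℤ} {K : ℝ} (hK : K = 1 - 7 * √6 / 18)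
    (hA : 0 < A) (hB : 0 < B) (hBA : B ≤ A) (h₁ : 0 < a₁) (h₁₂ : a₁ < a₂) (h₂₃ : a₂ < a₃)
    (e₁ : (A + a₁) * b₁ = a₁ * B) (e₂ : (A + a₂) * b₂ = a₂ * B) (e₃ : (A + a₃) * b₃ = a₃ * B) :
    A ≤ a₃ ^ 2 ∨ (A : ℝ) / (a₃ : ℝ) ^ 3 ≤ K * (1 + (a₃ : ℝ) / A) ^ 2 := by
  obtain ⟨p, q, r, t, E, F, hp, hq, hs, hpr, hpq, hla, hlb, hE, hF, hF0, hEF, hX,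
    hp', hq', hr', ht'⟩ := exists_area_data hA hB h₁ h₁₂ h₂₃ e₁ e₂ e₃
  have hAR : (0 : ℝ) < A := by exact_mod_cast hA
  have hBR : (0 : ℝ) < B := by exact_mod_cast hB
  have hBAR : (B : ℝ) ≤ A := by exact_mod_cast hBA
  have hu : (0 : ℝ) < a₁ := by exact_mod_cast h₁
  have hv : (0 : ℝ) < (a₂ : ℝ) - a₁ := by rw [sub_pos]; exact_mod_cast h₁₂
  have hw : (0 : ℝ) < (a₃ : ℝ) - a₂ := by rw [sub_pos]; exact_mod_cast h₂₃
  rify at hp' hq' hr' ht'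
  rcases lt_trichotomy p q with h | h | h
  · right
    have hsum : (a₃ : ℝ) - a₂ + (a₂ - a₁) + a₁ = a₃ := by ring
    have := ratio_le_of_areas (p := q) (q := p) (r := t) (t := r) hK hAR hBR hBAR hw hv hu hp h
      (by linarith) (by linarith) (hq'.trans_eq (by ring)) (hp'.trans_eq (by ring))
      (ht'.trans_eq (by ring)) (hr'.trans_eq (by ring)) (fun hex => by
        have := skew_bound (m := q * p * t * r) hA hB hBA h₁ h₁₂ h₂₃
          (hE ▸ hex.two_dvd_of_swap hla) (hF ▸ (hex.two_dvd_of_swap hlb).neg_right) hF0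
          (by rw [hEF]; ring) hX
        rw [hsum]
        exact_mod_cast this)
    rwa [hsum] at this
  · exact Or.inl (hpq h)
  · right
    have hsum : (a₁ : ℝ) + (a₂ - a₁) + (a₃ - a₂) = a₃ := by ring
    have := ratio_le_of_areas hK hAR hBR hBAR hu hv hw hq h hs hpr
      (hp'.trans_eq (by ring)) (hq'.trans_eq (by ring))
      (hr'.trans_eq (by ring)) (ht'.trans_eq (by ring)) (fun hex => by
        have := skew_bound hA hB hBA h₁ h₁₂ h₂₃
          (hE ▸ hex.two_dvd hla) (hF ▸ (hex.two_dvd hlb).neg_right) hF0 hEF hX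
        rw [hsum]
        exact_mod_cast this)
    rwa [hsum] at this

lemma limiting_constant_eq : (6 + √6) / (9 * (2 + √6) ^ 2) = 1 - 7 * √6 / 18 := by
  have hs : √6 ^ 2 = 6 := Real.sq_sqrt (by norm_num)
  have hs0 : 0 ≤ √6 := Real.sqrt_nonneg 6
  rw [div_eq_iff (by positivity)]
  linear_combination (7 / 2 * √6 + 5) * hs

/-- For numbers with four close factorizations, the ratio `A / a₃³` is at most
`(6 + √6)/(9·(2 + √6)²) + O(n^{-1/3})`. -/
theorem four_close_factorizations_ratio_bound :
    ∃ c : ℝ, 0 < c ∧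
      ∀ n A B a₁ a₂ a₃ b₁ b₂ b₃ : ℤ,
        0 < A → 0 < B → B ≤ A →
        0 < a₁ → a₁ < a₂ → a₂ < a₃ →
        0 < b₁ → b₁ < b₂ → b₂ < b₃ → b₃ < B →
        n = A * B →
        n = (A + a₁) * (B - b₁) →
        n = (A + a₂) * (B - b₂) →
        n = (A + a₃) * (B - b₃) →
        (A : ℝ) / (a₃ : ℝ) ^ 3 ≤
          (6 + Real.sqrt 6) / (9 * (2 + Real.sqrt 6) ^ 2)
            + c / (n : ℝ) ^ ((1 : ℝ) / 3) := by
  refine ⟨100, by norm_num, ?_⟩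
  intro n A B a₁ a₂ a₃ b₁ b₂ b₃ hA hB hBA h₁ h₁₂ h₂₃ _ _ _ _ hn hn₁ hn₂ hn₃
  rw [limiting_constant_eq]
  obtain ⟨K, hK⟩ : ∃ K : ℝ, K = 1 - 7 * √6 / 18 := ⟨_, rfl⟩
  rw [← hK]
  have hK0 : 0.0474 < K ∧ K < 0.05 := by
    have hs : √6 ^ 2 = 6 := Real.sq_sqrt (by norm_num)
    have hs0 : 0 ≤ √6 := Real.sqrt_nonneg 6
    rw [hK]
    constructor <;> nlinarith
  have hmain := le_sq_or_ratio_le (b₁ := b₁) (b₂ := b₂) (b₃ := b₃) hK hA hB hBA h₁ h₁₂ h₂₃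
    (by linarith) (by linarith) (by linarith)
  have hnpos : (0 : ℝ) < n := by rw [hn]; exact_mod_cast mul_pos hA hB
  obtain ⟨y, hy⟩ : ∃ y : ℝ, y = (n : ℝ) ^ ((1 : ℝ) / 3) := ⟨_, rfl⟩
  have hy0 : 0 < y := hy ▸ Real.rpow_pos_of_pos hnpos _
  have hy3 : y ^ 3 = n := by
    rw [hy, ← Real.rpow_natCast, ← Real.rpow_mul hnpos.le]
    norm_num
  rw [← hy]
  have hyA : y ^ 3 ≤ (A : ℝ) ^ 2 := by
    rw [hy3, hn, sq]
    exact_mod_cast mul_le_mul_of_nonneg_left hBA hA.le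
  have hAR : (0 : ℝ) < A := by exact_mod_cast hA
  have ha : (1 : ℝ) ≤ a₃ := by exact_mod_cast (by linarith : 1 ≤ a₃)
  have ha0 : (0 : ℝ) < a₃ := by linarith
  rcases le_or_gt ((A : ℝ) / (a₃ : ℝ) ^ 3) K with hle | hlt
  · have : 0 < 100 / y := by positivity
    linarith
  rw [lt_div_iff₀ (by positivity)] at hlt
  have hcube : (a₃ : ℝ) ^ 3 < 22 * A := by nlinarith [pow_pos ha0 3]
  rcases hmain with hsq | hR
  · have hsq' : (A : ℝ) ≤ (a₃ : ℝ) ^ 2 := by exact_mod_cast hsq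
    have ha22 : (a₃ : ℝ) < 22 := by nlinarith
    have hA484 : (A : ℝ) < 484 := by nlinarith
    have hy100 : y < 100 := by
      refine lt_of_pow_lt_pow_left₀ 3 (by norm_num) ?_
      nlinarith
    have h1 : 1 ≤ 100 / y := by rw [le_div_iff₀ hy0]; linarith
    have h2 : (A : ℝ) / (a₃ : ℝ) ^ 3 ≤ 1 := by
      rw [div_le_one (by positivity)]
      nlinarith
    linarith
  · obtain ⟨ε, hε⟩ : ∃ ε : ℝ, ε = (a₃ : ℝ) / A := ⟨_, rfl⟩
    rw [← hε] at hR
    have hε0 : 0 < ε := hε ▸ by positivity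
    have hε22 : ε < 22 := by
      rw [hε, div_lt_iff₀ hAR]
      exact (le_self_pow₀ ha (by norm_num)).trans_lt hcube
    have hεy : ε * y ≤ 3 := by
      refine le_of_pow_le_pow_left₀ (n := 3) (by norm_num) (by norm_num) ?_
      rw [mul_pow, hε, div_pow, div_mul_eq_mul_div, div_le_iff₀ (by positivity)]
      calc (a₃ : ℝ) ^ 3 * y ^ 3 ≤ 22 * A * (A : ℝ) ^ 2 := by gcongr
        _ ≤ 3 ^ 3 * (A : ℝ) ^ 3 := by nlinarith [pow_pos hAR 3]
    have h1 : ε ≤ 3 / y := by rwa [le_div_iff₀ hy0]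
    have h2 : K * (1 + ε) ^ 2 ≤ K + 2 * ε := by
      have hKε : K * (2 + ε) ≤ 0.05 * 24 := by gcongr <;> linarith
      nlinarith
    have h3 : 2 * (3 / y) ≤ 100 / y := by
      rw [mul_div_assoc']
      gcongr
      norm_num
    linarith
end

section
/- For every real ε > 0 there exist positive integers n, A, B, a₁, a₂, a₃, b₁, b₂, b₃ satisfying B ≤ A, a₁ < a₂ < a₃, b₁ < b₂ < b₃, b₃ < B, n = A·B = (A + a₁)·(B − b₁) = (A + a₂)·(B − b₂) = (A + a₃)·(B − b₃), and (as real numbers) A / a₃³ > (6 + √6) / (9·(2 + √6)²) − ε. In other words, the constant (6 + √6)/(9·(2 + √6)²) in the upper bound for A/a₃³ is best possible. -/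
/-- The Pell equation `u² - 6k² = 1` has positive solutions with `k` arbitrarily large. -/
lemma exists_pell_six_large (N : ℕ) :
    ∃ u k : ℤ, 0 < u ∧ (N : ℤ) < k ∧ u ^ 2 = 6 * k ^ 2 + 1 := by
  induction N with
  | zero => exact ⟨5, 2, by norm_num, by norm_num, by norm_num⟩
  | succ N ih =>
    obtain ⟨u, k, hu, hk, h⟩ := ih
    refine ⟨5 * u + 12 * k, 2 * u + 5 * k, by omega, by push_cast; omega, ?_⟩
    linear_combination h

/-- On the positive reals, `t ↦ (6 + t)/(9(2 + t)²)` decreases with slope at least `-1`. -/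
lemma ratio_function_sub_le {s t : ℝ} (hs : 0 < s) (hst : s ≤ t) :
    (6 + s) / (9 * (2 + s) ^ 2) - (6 + t) / (9 * (2 + t) ^ 2) ≤ t - s := by
  have ht : 0 < t := hs.trans_le hst
  have hsub : (6 + s) / (9 * (2 + s) ^ 2) - (6 + t) / (9 * (2 + t) ^ 2) =
      (t - s) * ((20 + 6 * (t + s) + s * t) / (9 * (2 + s) ^ 2 * (2 + t) ^ 2)) := by
    field_simp
    ring
  rw [hsub]
  refine mul_le_of_le_one_right (sub_nonneg.2 hst) ((div_le_one (by positivity)).2 ?_)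
  have h : 0 ≤ 124 + 138 * (t + s) + 143 * (s * t) + 36 * (s ^ 2 + t ^ 2)
      + 36 * (s * t * (s + t)) + 9 * (s * t) ^ 2 := by positivity
  linear_combination h

/-- The constant `(6 + √6)/(9·(2 + √6)²)` in the upper bound for `A/a₃³` for
numbers with four close factorizations is best possible. -/
theorem four_close_factorizations_ratio_optimal :
    ∀ ε : ℝ, 0 < ε →
      ∃ n A B a₁ a₂ a₃ b₁ b₂ b₃ : ℤ,
        0 < A ∧ 0 < B ∧ B ≤ A ∧
        0 < a₁ ∧ a₁ < a₂ ∧ a₂ < a₃ ∧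
        0 < b₁ ∧ b₁ < b₂ ∧ b₂ < b₃ ∧ b₃ < B ∧
        n = A * B ∧
        n = (A + a₁) * (B - b₁) ∧
        n = (A + a₂) * (B - b₂) ∧
        n = (A + a₃) * (B - b₃) ∧
        (A : ℝ) / (a₃ : ℝ) ^ 3 >
          (6 + Real.sqrt 6) / (9 * (2 + Real.sqrt 6) ^ 2) - ε := by
  intro ε hε
  obtain ⟨N, hN⟩ := exists_nat_gt (1 / ε)
  obtain ⟨u, k, hu, hNk, h⟩ := exists_pell_six_large N
  have hk : 0 < k := by omega
  have huk : 2 * k < u := by nlinarith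
  refine ⟨_, 3 * k * (u + 6 * k) * (u + 2 * k), 2 * u * (u + k) * (u + 3 * k),
    3 * k, u + 6 * k, 3 * (u + 2 * k), u, 2 * (u + k), 2 * (u + 3 * k),
    by positivity, by positivity, ?_, by omega, by omega, by omega, hu, by omega, by omega, ?_,
    rfl, ?_, ?_, ?_, ?_⟩
  · have hdiff : 3 * k * (u + 6 * k) * (u + 2 * k) - 2 * u * (u + k) * (u + 3 * k) =
        k * (6 * k ^ 2 - 5) + 2 * u * (3 * k ^ 2 - 1) := by
      linear_combination (-5 * k - 2 * u) * h
    have h1 : 0 < k * (6 * k ^ 2 - 5) := mul_pos hk (by nlinarith)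
    have h2 : 0 < 2 * u * (3 * k ^ 2 - 1) := mul_pos (by omega) (by nlinarith)
    omega
  · have h1 : 0 < (u * (u + k) - 1) * (u + 3 * k) := mul_pos (by nlinarith) (by omega)
    linear_combination 2 * h1
  · linear_combination (-3 * k * u) * h
  · linear_combination (-2 * (u + 6 * k) * (u + k)) * h
  · linear_combination (-6 * (u + 2 * k) * (u + 3 * k)) * h
  · have hkR : (0 : ℝ) < k := by exact_mod_cast hk
    have huR : (0 : ℝ) < u := by exact_mod_cast hu
    have hR : (u : ℝ) ^ 2 = 6 * (k : ℝ) ^ 2 + 1 := by exact_mod_cast h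
    have hNkR : (N : ℝ) < k := by exact_mod_cast hNk
    have hεk : 1 < ε * k := by
      have := (div_lt_iff₀ hε).1 (hN.trans hNkR)
      linarith
    have hs : 0 < √(6 : ℝ) := by positivity
    have hs2 : √(6 : ℝ) ^ 2 = 6 := Real.sq_sqrt (by norm_num)
    have hs1 : 1 ≤ √(6 : ℝ) := by nlinarith
    have hst : √(6 : ℝ) ≤ u / k := by
      rw [le_div_iff₀ hkR]
      exact le_of_sq_le_sq (by nlinarith) huR.le
    have hclose : (u : ℝ) / k - √6 < ε := by
      rw [sub_lt_iff_lt_add, div_lt_iff₀ hkR]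
      nlinarith [mul_pos hs hkR]
    have hratio : ((3 * k * (u + 6 * k) * (u + 2 * k) : ℤ) : ℝ) /
        ((3 * (u + 2 * k) : ℤ) : ℝ) ^ 3 = (6 + (u : ℝ) / k) / (9 * (2 + (u : ℝ) / k) ^ 2) := by
      push_cast
      field_simp
      ring
    rw [hratio]
    linarith [ratio_function_sub_le hs hst]
end

section
/- Let x and y be positive integers with x² − 6·y² = 1. Set a₁ = 3y, b₁ = x, a₂ = x + 6y, b₂ = 2x + 2y, a₃ = 3x + 6y, b₃ = 2x + 6y, A = 3y·(x + 2y)·(x + 6y), B = 2x·(x + y)·(x + 3y), and n = A·B. Then B ≤ A, a₁ < a₂ < a₃, b₁ < b₂ < b₃, b₃ < B, and n = A·B = (A + a₁)·(B − b₁) = (A + a₂)·(B − b₂) = (A + a₃)·(B − b₃); moreover A / a₃³ = y·(x + 6y) / (9·(x + 2y)²) as real numbers. -/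
/-- The explicit family built from solutions of the Pell equation `x² − 6y² = 1`
of numbers with four close factorizations. -/
theorem pell_family_four_close_factorizations
    (x y : ℤ) (hx : 0 < x) (hy : 0 < y)
    (hpell : x ^ 2 - 6 * y ^ 2 = 1)
    (a₁ a₂ a₃ b₁ b₂ b₃ A B n : ℤ)
    (ha₁ : a₁ = 3 * y) (hb₁ : b₁ = x)
    (ha₂ : a₂ = x + 6 * y) (hb₂ : b₂ = 2 * x + 2 * y)
    (ha₃ : a₃ = 3 * x + 6 * y) (hb₃ : b₃ = 2 * x + 6 * y)
    (hA : A = 3 * y * (x + 2 * y) * (x + 6 * y))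
    (hB : B = 2 * x * (x + y) * (x + 3 * y))
    (hn : n = A * B) :
    B ≤ A ∧ a₁ < a₂ ∧ a₂ < a₃ ∧ b₁ < b₂ ∧ b₂ < b₃ ∧ b₃ < B ∧
      n = A * B ∧
      n = (A + a₁) * (B - b₁) ∧
      n = (A + a₂) * (B - b₂) ∧
      n = (A + a₃) * (B - b₃) ∧
      (A : ℝ) / (a₃ : ℝ) ^ 3 =
        (y : ℝ) * ((x : ℝ) + 6 * (y : ℝ)) / (9 * ((x : ℝ) + 2 * (y : ℝ)) ^ 2) := by
  subst b₁
  subst hn ha₁ ha₂ hb₂ ha₃ hb₃ hA hB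
  refine ⟨?_, by linarith, by linarith, by linarith, by linarith, ?_, rfl, ?_, ?_, ?_, ?_⟩
  · have hgap : 3 * y * (x + 2 * y) * (x + 6 * y) - 2 * x * (x + y) * (x + 3 * y)
        = 2 * x * (3 * y ^ 2 - 1) + y * (6 * y ^ 2 - 5) := by
      linear_combination (-2 * x - 5 * y) * hpell
    have hy2 : 1 ≤ y ^ 2 := one_le_pow₀ hy
    have h₁ : 0 ≤ 2 * x * (3 * y ^ 2 - 1) := mul_nonneg (by linarith) (by linarith)
    have h₂ : 0 ≤ y * (6 * y ^ 2 - 5) := mul_nonneg hy.le (by linarith)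
    linarith
  · have h : 1 < x * (x + y) := by nlinarith
    nlinarith
  · linear_combination (-(3 * x * y)) * hpell
  · linear_combination (-(2 * (x + y) * (x + 6 * y))) * hpell
  · linear_combination (-(6 * (x + 2 * y) * (x + 3 * y))) * hpell
  · have hpos : (0 : ℝ) < x + 2 * y := by exact_mod_cast (by linarith : 0 < x + 2 * y)
    have hthree : (3 * x + 6 * y : ℝ) = 3 * (x + 2 * y) := by ring
    push_cast
    rw [hthree]
    field_simp
    norm_num
end

section
/- In the four close factorizations setup, for all indices 1 ≤ j < i ≤ 3, setting D_{ij} := a_i·b_j − a_j·b_i, one has D_{ij} ≥ 1, B·D_{ij} = b_i·b_j·(a_i − a_j), and A·D_{ij} = a_i·a_j·(b_i − b_j). -/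
/-- In the four close factorizations setup, for all indices `1 ≤ j < i ≤ 3`, the skew
`D_{ij} = a_i·b_j − a_j·b_i` satisfies `D_{ij} ≥ 1`, `B·D_{ij} = b_i·b_j·(a_i − a_j)`,
and `A·D_{ij} = a_i·a_j·(b_i − b_j)`. -/
theorem four_close_factorizations_skews
    (n A B : ℤ) (a b : Fin 3 → ℤ)
    (hApos : 0 < A) (hBpos : 0 < B) (hBA : B ≤ A)
    (ha0 : 0 < a 0) (ha01 : a 0 < a 1) (ha12 : a 1 < a 2)
    (hb0 : 0 < b 0) (hb01 : b 0 < b 1) (hb12 : b 1 < b 2)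
    (hb2B : b 2 < B)
    (hn : n = A * B)
    (hfac : ∀ i : Fin 3, n = (A + a i) * (B - b i)) :
    ∀ i j : Fin 3, j < i →
      1 ≤ a i * b j - a j * b i ∧
      B * (a i * b j - a j * b i) = b i * b j * (a i - a j) ∧
      A * (a i * b j - a j * b i) = a i * a j * (b i - b j) := by
  have ha : ∀ i j : Fin 3, j < i → a j < a i := by
    intro i j hij
    fin_cases i <;> fin_cases j <;> simp at hij ⊢ <;> linarith
  have hb : ∀ i : Fin 3, 0 < b i := by
    intro i
    fin_cases i <;> simp <;> linarith
  have hkey : ∀ i : Fin 3, a i * B = A * b i + a i * b i := fun i => by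
    linear_combination hn - hfac i
  intro i j hij
  have hB : B * (a i * b j - a j * b i) = b i * b j * (a i - a j) := by
    linear_combination b j * hkey i - b i * hkey j
  refine ⟨?_, hB, by linear_combination a j * hkey i - a i * hkey j⟩
  have hpos : 0 < B * (a i * b j - a j * b i) := by
    rw [hB]
    exact mul_pos (mul_pos (hb i) (hb j)) (sub_pos.mpr (ha i j hij))
  exact pos_of_mul_pos_right hpos hBpos.le
end

section
/- In the four close factorizations setup, one has a_i > b_i for every i ∈ {1, 2, 3}, and a_i − a_j > b_i − b_j for all indices 1 ≤ j < i ≤ 3. -/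
/-- If `X * Y = (X + c) * (Y - d)` with `0 < Y ≤ X` and `0 < c`, then `d < c`. -/
theorem lt_of_mul_eq_add_mul_sub {X Y c d : ℤ} (hY : 0 < Y) (hYX : Y ≤ X) (hc : 0 < c)
    (h : X * Y = (X + c) * (Y - d)) : d < c := by
  by_contra! hcd
  have hX : 0 < X := hY.trans_le hYX
  have hdX : c * X ≤ d * X := mul_le_mul_of_nonneg_right hcd hX.le
  have hcY : c * Y ≤ c * X := mul_le_mul_of_nonneg_left hYX hc.le
  have hpos : 0 < c * d := mul_pos hc (hc.trans_le hcd)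
  linarith

/-- In the four close factorizations setup, `a_i > b_i` for every `i`, and
`a_i − a_j > b_i − b_j` for all `1 ≤ j < i ≤ 3`. -/
theorem four_close_factorizations_a_gt_b
    (n A B : ℤ) (a b : Fin 3 → ℤ)
    (hApos : 0 < A) (hBpos : 0 < B) (hBA : B ≤ A)
    (ha0 : 0 < a 0) (ha01 : a 0 < a 1) (ha12 : a 1 < a 2)
    (hb0 : 0 < b 0) (hb01 : b 0 < b 1) (hb12 : b 1 < b 2)
    (hb2B : b 2 < B)
    (hn : n = A * B)
    (hfac : ∀ i : Fin 3, n = (A + a i) * (B - b i)) :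
    (∀ i : Fin 3, a i > b i) ∧
    (∀ i j : Fin 3, j < i → a i - a j > b i - b j) := by
  have pair {i j : Fin 3} (haj : 0 < a j) (hbj : 0 < b j) (hbjB : b j < B)
      (hij : a j < a i) : b i - b j < a i - a j := by
    refine lt_of_mul_eq_add_mul_sub (X := A + a j) (Y := B - b j) (by linarith) (by linarith)
      (by linarith) ?_
    linear_combination hfac i - hfac j
  refine ⟨fun i => ?_, fun i j hji => ?_⟩
  · refine lt_of_mul_eq_add_mul_sub hBpos hBA ?_ (hn.symm.trans (hfac i))
    fin_cases i <;> simp <;> linarith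
  · apply pair <;> fin_cases i <;> fin_cases j <;> simp at hji ⊢ <;> linarith
end

section
/- In the four close factorizations setup, the skews satisfy D₃₁ > D₂₁. -/
/-- In the four close factorizations setup, the skews satisfy `D₃₁ > D₂₁`. -/
theorem four_close_factorizations_D31_gt_D21
    (n A B a₁ a₂ a₃ b₁ b₂ b₃ D₂₁ D₃₁ D₃₂ : ℤ)
    (hApos : 0 < A) (hBpos : 0 < B) (hBA : B ≤ A)
    (ha₁ : 0 < a₁) (ha12 : a₁ < a₂) (ha23 : a₂ < a₃)
    (hb₁ : 0 < b₁) (hb12 : b₁ < b₂) (hb23 : b₂ < b₃)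
    (hb₃B : b₃ < B)
    (hn : n = A * B)
    (h1 : n = (A + a₁) * (B - b₁))
    (h2 : n = (A + a₂) * (B - b₂))
    (h3 : n = (A + a₃) * (B - b₃))
    (hD21 : D₂₁ = a₂ * b₁ - a₁ * b₂)
    (hD31 : D₃₁ = a₃ * b₁ - a₁ * b₃)
    (hD32 : D₃₂ = a₃ * b₂ - a₂ * b₃) :
    D₃₁ > D₂₁ := by
  have first_chord : b₁ * (A + a₁) = a₁ * B := by linarith
  have last_chord : (b₃ - b₂) * (A + a₃) = (a₃ - a₂) * (B - b₂) := by linarith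
  have ha_pos : 0 < a₁ * (a₃ - a₂) := mul_pos ha₁ (by linarith)
  have slopes : (B - b₂) * (A + a₁) < B * (A + a₃) :=
    mul_lt_mul'' (by linarith) (by linarith) (by linarith) (by linarith)
  have scaled : a₁ * (b₃ - b₂) * ((A + a₁) * (A + a₃)) <
      (a₃ - a₂) * b₁ * ((A + a₁) * (A + a₃)) :=
    calc a₁ * (b₃ - b₂) * ((A + a₁) * (A + a₃))
        = a₁ * (a₃ - a₂) * ((B - b₂) * (A + a₁)) := by
          linear_combination a₁ * (A + a₁) * last_chord
      _ < a₁ * (a₃ - a₂) * (B * (A + a₃)) := mul_lt_mul_of_pos_left slopes ha_pos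
      _ = (a₃ - a₂) * b₁ * ((A + a₁) * (A + a₃)) := by
          linear_combination -(a₃ - a₂) * (A + a₃) * first_chord
  have cross : a₁ * (b₃ - b₂) < (a₃ - a₂) * b₁ :=
    lt_of_mul_lt_mul_right scaled (mul_nonneg (by linarith) (by linarith))
  linarith
end

section
/- In the four close factorizations setup, the skews satisfy D₃₂ + D₂₁ > D₃₁. -/
/-- Three points with increasing abscissae on a branch of a hyperbola `x * y = n` turn
counterclockwise. -/
theorem hyperbola_chord_cross_pos {x₁ x₂ x₃ y₁ y₂ y₃ : ℤ} (hx12 : x₁ < x₂) (hx23 : x₂ < x₃)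
    (hy12 : y₂ < y₁) (hy23 : y₃ < y₂) (hy₂ : 0 < y₂)
    (h12 : x₁ * y₁ = x₂ * y₂) (h23 : x₂ * y₂ = x₃ * y₃) :
    (x₂ - x₁) * (y₂ - y₃) < (x₃ - x₂) * (y₁ - y₂) := by
  have key : y₂ * ((x₃ - x₂) * (y₁ - y₂) - (x₂ - x₁) * (y₂ - y₃)) =
      (y₁ - y₂) * (y₂ - y₃) * (x₃ - x₁) := by
    linear_combination (y₂ - y₃) * h12 - (y₁ - y₂) * h23
  have hpos : 0 < (y₁ - y₂) * (y₂ - y₃) * (x₃ - x₁) :=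
    mul_pos (mul_pos (by linarith) (by linarith)) (by linarith)
  rw [← key] at hpos
  exact sub_pos.mp (pos_of_mul_pos_right hpos hy₂.le)

/-- In the four close factorizations setup, the skews satisfy `D₃₂ + D₂₁ > D₃₁`. -/
theorem four_close_factorizations_skew_triangle
    (n A B a₁ a₂ a₃ b₁ b₂ b₃ D₂₁ D₃₁ D₃₂ : ℤ)
    (hApos : 0 < A) (hBpos : 0 < B) (hBA : B ≤ A)
    (ha₁ : 0 < a₁) (ha12 : a₁ < a₂) (ha23 : a₂ < a₃)
    (hb₁ : 0 < b₁) (hb12 : b₁ < b₂) (hb23 : b₂ < b₃)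
    (hb₃B : b₃ < B)
    (hn : n = A * B)
    (h1 : n = (A + a₁) * (B - b₁))
    (h2 : n = (A + a₂) * (B - b₂))
    (h3 : n = (A + a₃) * (B - b₃))
    (hD21 : D₂₁ = a₂ * b₁ - a₁ * b₂)
    (hD31 : D₃₁ = a₃ * b₁ - a₁ * b₃)
    (hD32 : D₃₂ = a₃ * b₂ - a₂ * b₃) :
    D₃₂ + D₂₁ > D₃₁ := by
  have h := hyperbola_chord_cross_pos (x₁ := A + a₁) (x₂ := A + a₂) (x₃ := A + a₃)
    (y₁ := B - b₁) (y₂ := B - b₂) (y₃ := B - b₃) (by linarith) (by linarith) (by linarith)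
    (by linarith) (by linarith) (h1.symm.trans h2) (h2.symm.trans h3)
  subst hD21 hD31 hD32
  linarith
end

section
/- In the four close factorizations setup, let C be a positive integer with a₃ ≤ C and b₃ ≤ C, let 1 ≤ j < i ≤ 3, and suppose a_i = (1 + λ)·a_j for some real λ > 0. Then, with D_{ij} := a_i·b_j − a_j·b_i, one has (as real numbers) B ≤ A < λ·C³ / (D_{ij}·(1 + λ)²). -/
/-- If `A * B = (A + a) * (B - b) = (A + x) * (B - y)`, then the skew `a * y - x * b` satisfies
`A * (a * y - x * b) = a * x * (b - y)`. -/
lemma mul_skew_eq {R : Type*} [CommRing R] {A B a b x y : R}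
    (h₁ : A * B = (A + a) * (B - b)) (h₂ : A * B = (A + x) * (B - y)) :
    A * (a * y - x * b) = a * x * (b - y) := by
  linear_combination a * h₂ - x * h₁

/-- Two factorizations `(A + a) * (B - b) = (A + x) * (B - y)` of `A * B` with `a = (1 + l) * x`
and `a, b ≤ C` force `A` to be small compared with `C`. -/
lemma lt_div_skew_of_factorizations {A B a b x y C l : ℝ} (hA : 0 < A) (hx : 0 < x) (hy : 0 < y)
    (hyb : y < b) (haC : a ≤ C) (hbC : b ≤ C) (hl : 0 < l) (hrel : a = (1 + l) * x)
    (h₁ : A * B = (A + a) * (B - b)) (h₂ : A * B = (A + x) * (B - y)) :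
    A < l * C ^ 3 / ((a * y - x * b) * (1 + l) ^ 2) := by
  have hkey := mul_skew_eq h₁ h₂
  have ha : 0 < a := by rw [hrel]; positivity
  have hb : 0 < b := hy.trans hyb
  have hD : 0 < a * y - x * b := by
    have : 0 < A * (a * y - x * b) := by
      rw [hkey]; exact mul_pos (mul_pos ha hx) (sub_pos.2 hyb)
    exact pos_of_mul_pos_right this hA.le
  have hby : b < (1 + l) * y := by
    rw [hrel] at hD
    refine lt_of_mul_lt_mul_left ?_ hx.le
    linarith
  rw [lt_div_iff₀ (by positivity)]
  calc A * ((a * y - x * b) * (1 + l) ^ 2)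
      = a ^ 2 * ((1 + l) * (b - y)) := by
        linear_combination (1 + l) ^ 2 * hkey - a * (1 + l) * (b - y) * hrel
    _ < a ^ 2 * (l * b) := mul_lt_mul_of_pos_left (by linarith) (by positivity)
    _ ≤ C ^ 2 * (l * C) := by gcongr
    _ = l * C ^ 3 := by ring

/-- In the four close factorizations setup, if `a_i = (1 + λ)·a_j` for some
`1 ≤ j < i ≤ 3` and real `λ > 0`, and `a₃, b₃ ≤ C`, then
`B ≤ A < λ·C³ / (D_{ij}·(1 + λ)²)`. -/
theorem four_close_factorizations_lambda_bound
    (n A B : ℤ) (a b : Fin 3 → ℤ) (C : ℤ)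
    (hApos : 0 < A) (hBpos : 0 < B) (hBA : B ≤ A)
    (ha0 : 0 < a 0) (ha01 : a 0 < a 1) (ha12 : a 1 < a 2)
    (hb0 : 0 < b 0) (hb01 : b 0 < b 1) (hb12 : b 1 < b 2)
    (hb2B : b 2 < B)
    (hn : n = A * B)
    (hfac : ∀ i : Fin 3, n = (A + a i) * (B - b i))
    (hCpos : 0 < C) (haC : a 2 ≤ C) (hbC : b 2 ≤ C)
    (i j : Fin 3) (hij : j < i)
    (lam : ℝ) (hlam : 0 < lam)
    (hrel : (a i : ℝ) = (1 + lam) * (a j : ℝ)) :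
    (B : ℝ) ≤ (A : ℝ) ∧
      (A : ℝ) < lam * (C : ℝ) ^ 3 /
        (((a i * b j - a j * b i : ℤ) : ℝ) * (1 + lam) ^ 2) := by
  have hfac' (k : Fin 3) : (A : ℝ) * B = (A + a k) * (B - b k) := by
    exact_mod_cast hn.symm.trans (hfac k)
  have hamono : StrictMono a := by
    rw [Fin.strictMono_iff_lt_succ]; intro k; fin_cases k <;> assumption
  have hbmono : StrictMono b := by
    rw [Fin.strictMono_iff_lt_succ]; intro k; fin_cases k <;> assumption
  have haj : 0 < a j := ha0.trans_le (hamono.monotone (Fin.zero_le j))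
  have hbj : 0 < b j := hb0.trans_le (hbmono.monotone (Fin.zero_le j))
  have hai : a i ≤ C := (hamono.monotone (Fin.le_last i)).trans haC
  have hbi : b i ≤ C := (hbmono.monotone (Fin.le_last i)).trans hbC
  refine ⟨by exact_mod_cast hBA, ?_⟩
  push_cast
  exact lt_div_skew_of_factorizations (by exact_mod_cast hApos) (by exact_mod_cast haj)
    (by exact_mod_cast hbj) (by exact_mod_cast hbmono hij) (by exact_mod_cast hai)
    (by exact_mod_cast hbi) hlam hrel (hfac' i) (hfac' j)
end

section
/- In the four close factorizations setup, let C be a positive integer with a₃ ≤ C and b₃ ≤ C. If at least one of the skews D₂₁, D₃₁, D₃₂ is greater than 5, then 24·A ≤ C³ (so in particular B ≤ A ≤ C³/24 < 0.042·C³). -/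
/-- Two factorizations `A * B = (A + a) * (B - b) = (A + a') * (B - b')` with `a < a'` and skew
`a' * b - a * b'` greater than `5` force `24 * A ≤ a' ^ 3`. -/
theorem mul_le_cube_of_skew {A B a a' b b' : ℤ} (hA : 0 < A) (hBA : B ≤ A)
    (ha : 0 < a) (haa : a < a') (hb : 0 < b)
    (h : A * B = (A + a) * (B - b)) (h' : A * B = (A + a') * (B - b'))
    (hD : 5 < a' * b - a * b') : 24 * A ≤ a' ^ 3 := by
  have hba : b ≤ a := by
    by_contra! hlt
    nlinarith [mul_pos ha hb]
  have hkey : (a' * b - a * b') * A = a' * (a * (b' - b)) := by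
    linear_combination a' * h - a * h'
  have hdiff : a * (b' - b) ≤ a * (a' - a) := by
    nlinarith [mul_le_mul_of_nonneg_right hba (sub_nonneg.2 haa.le)]
  have hamgm : 4 * (a * (a' - a)) ≤ a' ^ 2 := by
    nlinarith [sq_nonneg (a' - 2 * a)]
  have hsix : 6 * A ≤ (a' * b - a * b') * A :=
    mul_le_mul_of_nonneg_right hD hA.le
  have hcube : a' * (4 * (a * (b' - b))) ≤ a' * a' ^ 2 :=
    mul_le_mul_of_nonneg_left (by linarith) (ha.trans haa).le
  linarith [pow_succ' a' 2]

/-- In the four close factorizations setup with `a₃ ≤ C` and `b₃ ≤ C`, if one of the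
skews `D₂₁, D₃₁, D₃₂` exceeds `5`, then `24·A ≤ C³`. -/
theorem four_close_factorizations_large_skew_bound
    (n A B a₁ a₂ a₃ b₁ b₂ b₃ D₂₁ D₃₁ D₃₂ C : ℤ)
    (hApos : 0 < A) (hBpos : 0 < B) (hBA : B ≤ A)
    (ha₁ : 0 < a₁) (ha12 : a₁ < a₂) (ha23 : a₂ < a₃)
    (hb₁ : 0 < b₁) (hb12 : b₁ < b₂) (hb23 : b₂ < b₃)
    (hb₃B : b₃ < B)
    (hn : n = A * B)
    (h1 : n = (A + a₁) * (B - b₁))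
    (h2 : n = (A + a₂) * (B - b₂))
    (h3 : n = (A + a₃) * (B - b₃))
    (hD21 : D₂₁ = a₂ * b₁ - a₁ * b₂)
    (hD31 : D₃₁ = a₃ * b₁ - a₁ * b₃)
    (hD32 : D₃₂ = a₃ * b₂ - a₂ * b₃)
    (hCpos : 0 < C) (haC : a₃ ≤ C) (hbC : b₃ ≤ C)
    (hbig : 5 < D₂₁ ∨ 5 < D₃₁ ∨ 5 < D₃₂) :
    24 * A ≤ C ^ 3 := by
  subst hn hD21 hD31 hD32
  have hcube {x : ℤ} (hx : 0 < x) (hxC : x ≤ C) (h : 24 * A ≤ x ^ 3) : 24 * A ≤ C ^ 3 :=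
    h.trans (pow_le_pow_left₀ hx.le hxC 3)
  rcases hbig with h | h | h
  · exact hcube (by linarith) (by linarith) (mul_le_cube_of_skew hApos hBA ha₁ ha12 hb₁ h1 h2 h)
  · exact hcube (by linarith) haC
      (mul_le_cube_of_skew hApos hBA ha₁ (ha12.trans ha23) hb₁ h1 h3 h)
  · exact hcube (by linarith) haC
      (mul_le_cube_of_skew hApos hBA (ha₁.trans ha12) ha23 (hb₁.trans hb12) h2 h3 h)
end

section
/- In the four close factorizations setup, if D₃₁ = 5 and D₃₂ = 4, then 25·A ≤ a₃³ (equivalently, the ratio R₄ = A/a₃³ is at most 0.04). -/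
/-- Arithmetic of the pair `p (2 q² - 5 v²) = 15 v` with `v ≡ q [ZMOD 3]`, `q < p`:
the only possibility is `p = 5 v`. -/
lemma eq_five_mul_of_mul_eq_fifteen_mul {p q s v : ℤ} (hq : 0 < q) (hqp : q < p) (hv : 0 < v)
    (hvs : v = 3 * s - 2 * q) (h : p * (2 * q ^ 2 - 5 * v ^ 2) = 15 * v) : p = 5 * v := by
  obtain ⟨k, hk⟩ : ∃ k, k = 2 * q ^ 2 - 5 * v ^ 2 := ⟨_, rfl⟩
  rw [← hk] at h
  have hkpos : 0 < k := by
    by_contra hneg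
    nlinarith
  have hk10 : k < 10 := by
    by_contra hge
    have h2q : 2 * q ≤ 3 * v := by nlinarith
    nlinarith
  have hk3 : k = 3 * (-6 * q ^ 2 + 20 * (s * q) - 15 * s ^ 2) := by
    rw [hk, hvs]; ring
  have hmod : q ^ 2 % 5 = 0 ∨ q ^ 2 % 5 = 1 ∨ q ^ 2 % 5 = 4 := by
    have : q % 5 = 0 ∨ q % 5 = 1 ∨ q % 5 = 2 ∨ q % 5 = 3 ∨ q % 5 = 4 := by omega
    rcases this with h | h | h | h | h <;> simp [pow_two, Int.mul_emod, h]
  have hkeq : k = 3 := by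
    generalize q ^ 2 = x at *
    generalize v ^ 2 = y at *
    omega
  subst hkeq
  linarith

/-- Two factorizations `A B = (A + a) (B - b) = (A + a') (B - b')` determine `A` from the
offsets and their skew. -/
lemma mul_skew_eq_s11 {A B a b a' b' : ℤ} (h : A * B = (A + a) * (B - b))
    (h' : A * B = (A + a') * (B - b')) :
    A * (a' * b - a * b') = a * a' * (b' - b) := by
  linear_combination a' * h - a * h'

/-- If `A B = (A + a) (B - b)` with `B ≤ A`, then `b < a`. -/
lemma offset_lt {A B a b : ℤ} (hA : 0 < A) (hBA : B ≤ A) (ha : 0 < a)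
    (h : A * B = (A + a) * (B - b)) : b < a := by
  by_contra hle
  nlinarith

/-- The case `D₂₁ = 2`, in the basis `(p, q) = (a₁, b₁)`, `(r, s) = (a₂ / 2, b₂ / 2)`:
the slope `b₃ / a₃` is at most `4 / 5`. -/
lemma slope_le_of_skew_two {p q r s : ℤ} (hq : 0 < q) (hqp : q < p)
    (hr : p < 2 * r) (hs : q < 2 * s) (hdet : r * q - p * s = 1)
    (hquad : 15 * (r * s) - 10 * (r * q) - 10 * (p * s) + 6 * (p * q) = 0) :
    5 * (5 * s - 2 * q) ≤ 4 * (5 * r - 2 * p) := by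
  obtain ⟨u, hu⟩ : ∃ u, u = 3 * r - 2 * p := ⟨_, rfl⟩
  obtain ⟨v, hv⟩ : ∃ v, v = 3 * s - 2 * q := ⟨_, rfl⟩
  have huv : 5 * (u * v) = 2 * (p * q) := by
    rw [hu, hv]; linear_combination 3 * hquad
  have hdet' : u * q - p * v = 3 := by
    rw [hu, hv]; linear_combination 3 * hdet
  have hp : 0 < p := hq.trans hqp
  have hpq : 0 < p * q := mul_pos hp hq
  have hvpos : 0 < v := by
    by_contra hneg
    have huneg : u < 0 := by
      by_contra hu0
      nlinarith [mul_nonneg (not_lt.mp hu0) (neg_nonneg.mpr (not_lt.mp hneg))]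
    have h₁ : 0 < p + 2 * u := by omega
    have h₂ : 0 < q + 2 * v := by omega
    nlinarith [mul_pos h₁ hq, mul_nonneg (neg_nonneg.mpr huneg.le) h₂.le]
  have hpv : p = 5 * v := by
    refine eq_five_mul_of_mul_eq_fifteen_mul hq hqp hvpos hv ?_
    linear_combination (-q) * huv + 5 * v * hdet'
  have huq : u = 2 * q := by
    have : v * (u - 2 * q) = 0 := by rw [hpv] at huv; linarith
    rcases mul_eq_zero.mp this with h | h <;> omega
  omega

/-- In the four close factorizations setup, if `D₃₁ = 5` and `D₃₂ = 4`,
then `25·A ≤ a₃³` (i.e., `R₄ = A/a₃³ ≤ 0.04`). -/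
theorem four_close_factorizations_D31_five_D32_four
    (n A B a₁ a₂ a₃ b₁ b₂ b₃ D₂₁ D₃₁ D₃₂ : ℤ)
    (hApos : 0 < A) (hBpos : 0 < B) (hBA : B ≤ A)
    (ha₁ : 0 < a₁) (ha12 : a₁ < a₂) (ha23 : a₂ < a₃)
    (hb₁ : 0 < b₁) (hb12 : b₁ < b₂) (hb23 : b₂ < b₃)
    (hb₃B : b₃ < B)
    (hn : n = A * B)
    (h1 : n = (A + a₁) * (B - b₁))
    (h2 : n = (A + a₂) * (B - b₂))
    (h3 : n = (A + a₃) * (B - b₃))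
    (hD21 : D₂₁ = a₂ * b₁ - a₁ * b₂)
    (hD31 : D₃₁ = a₃ * b₁ - a₁ * b₃)
    (hD32 : D₃₂ = a₃ * b₂ - a₂ * b₃)
    (h5 : D₃₁ = 5) (h4 : D₃₂ = 4) :
    25 * A ≤ a₃ ^ 3 := by
  subst hn hD31 hD32
  have e31 := mul_skew_eq_s11 h1 h3
  have e32 := mul_skew_eq_s11 h2 h3
  have e21 := mul_skew_eq_s11 h1 h2
  rw [h5] at e31
  rw [h4] at e32
  rw [← hD21] at e21
  have hb₃a : b₃ < a₃ := offset_lt hApos hBA (by omega) h3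
  have hb₁a : b₁ < a₁ := offset_lt hApos hBA ha₁ h1
  have hlin_a : D₂₁ * a₃ = 5 * a₂ - 4 * a₁ := by
    rw [hD21]; linear_combination a₂ * h5 - a₁ * h4
  have hlin_b : D₂₁ * b₃ = 5 * b₂ - 4 * b₁ := by
    rw [hD21]; linear_combination b₂ * h5 - b₁ * h4
  have hDpos : 0 < D₂₁ := by
    by_contra hneg
    nlinarith
  have hDlt : D₂₁ < 5 := by
    by_contra hge
    nlinarith
  have ha₃ : 0 < a₃ := by omega
  have hA31 : 5 * A ≤ a₁ * (a₃ - a₁) * b₃ := by nlinarith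
  have hA32 : 4 * A ≤ a₂ * (a₃ - a₂) * b₃ := by nlinarith
  have large_a₂ : 4 * a₃ ≤ 5 * a₂ → 25 * A ≤ a₃ ^ 3 := by
    intro h
    have hA : 4 * A ≤ a₂ * (a₃ - a₂) * a₃ :=
      hA32.trans (mul_le_mul_of_nonneg_left hb₃a.le
        (mul_nonneg (by omega) (by omega)))
    have hq : 25 * (a₂ * (a₃ - a₂)) ≤ 4 * a₃ ^ 2 := by
      nlinarith [mul_nonneg (sub_nonneg.mpr h) (show 0 ≤ 5 * a₂ - a₃ by omega)]
    linarith [mul_le_mul_of_nonneg_right hq ha₃.le]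
  obtain hD | hD | hD | hD : D₂₁ = 1 ∨ D₂₁ = 2 ∨ D₂₁ = 3 ∨ D₂₁ = 4 := by omega
  · subst hD
    have ha : a₃ = 5 * a₂ - 4 * a₁ := by linarith
    have hb : b₃ = 5 * b₂ - 4 * b₁ := by linarith
    subst ha hb
    have : a₁ * (b₂ - b₁) * (a₂ - a₁) = 0 := by nlinarith
    have : 0 < a₁ * (b₂ - b₁) * (a₂ - a₁) :=
      mul_pos (mul_pos ha₁ (by omega)) (by omega)
    omega
  · subst hD
    obtain ⟨r, rfl⟩ : ∃ r, a₂ = 2 * r := ⟨a₂ / 2, by omega⟩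
    obtain ⟨s, rfl⟩ : ∃ s, b₂ = 2 * s := ⟨b₂ / 2, by omega⟩
    have ha : a₃ = 5 * r - 2 * a₁ := by linarith
    have hb : b₃ = 5 * s - 2 * b₁ := by linarith
    have hslope : 5 * b₃ ≤ 4 * a₃ := by
      rw [ha, hb]
      refine slope_le_of_skew_two hb₁ hb₁a ha12 hb12 (by linarith) ?_
      rw [ha, hb] at e31
      refine (mul_eq_zero.mp ?_).resolve_left ha₁.ne'
      have e21' : A = a₁ * r * (2 * s - b₁) := by linarith
      linear_combination 5 * e21' - e31
    have hq : 4 * (a₁ * (a₃ - a₁)) ≤ a₃ ^ 2 := by nlinarith [sq_nonneg (a₃ - 2 * a₁)]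
    have hb₃ : 0 ≤ b₃ := by omega
    linarith [mul_le_mul_of_nonneg_right hq hb₃,
      mul_le_mul_of_nonneg_left hslope (sq_nonneg a₃)]
  · subst hD
    rcases le_total a₃ (4 * a₁) with h | h
    · exact large_a₂ (by omega)
    · have hA : 5 * A ≤ a₁ * (a₃ - a₁) * a₃ :=
        hA31.trans (mul_le_mul_of_nonneg_left hb₃a.le
          (mul_nonneg (by omega) (by omega)))
      have hq : 5 * (a₁ * (a₃ - a₁)) ≤ a₃ ^ 2 := by
        nlinarith [mul_nonneg (sub_nonneg.mpr h) (show 0 ≤ 3 * a₃ - 4 * a₁ by omega)]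
      linarith [mul_le_mul_of_nonneg_right hq ha₃.le]
  · subst hD
    exact large_a₂ (by omega)
end

section
/- In the four close factorizations setup, suppose D₃₁ = D₃₂. Then A·(A + a₃) = (A + a₁)·(A + a₂), B·(B − b₃) = (B − b₁)·(B − b₂), A·(a₃ − a₂ − a₁) = a₁·a₂ (in particular a₃ ≥ a₁ + a₂ + 1), and 4·A < a₃². Consequently, if a₃ ≤ C then B ≤ A ≤ C²/4. -/
/-- In the four close factorizations setup, if `D₃₁ = D₃₂` then
`A·(A + a₃) = (A + a₁)·(A + a₂)`, `B·(B − b₃) = (B − b₁)·(B − b₂)`,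
`A·(a₃ − a₂ − a₁) = a₁·a₂`, `a₃ ≥ a₁ + a₂ + 1`, `4·A < a₃²`, and
consequently `4·A ≤ C²` whenever `a₃ ≤ C`. -/
theorem four_close_factorizations_equal_skews
    (n A B a₁ a₂ a₃ b₁ b₂ b₃ D₂₁ D₃₁ D₃₂ : ℤ)
    (hApos : 0 < A) (hBpos : 0 < B) (hBA : B ≤ A)
    (ha₁ : 0 < a₁) (ha12 : a₁ < a₂) (ha23 : a₂ < a₃)
    (hb₁ : 0 < b₁) (hb12 : b₁ < b₂) (hb23 : b₂ < b₃)
    (hb₃B : b₃ < B)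
    (hn : n = A * B)
    (h1 : n = (A + a₁) * (B - b₁))
    (h2 : n = (A + a₂) * (B - b₂))
    (h3 : n = (A + a₃) * (B - b₃))
    (hD21 : D₂₁ = a₂ * b₁ - a₁ * b₂)
    (hD31 : D₃₁ = a₃ * b₁ - a₁ * b₃)
    (hD32 : D₃₂ = a₃ * b₂ - a₂ * b₃)
    (heq : D₃₁ = D₃₂) :
    A * (A + a₃) = (A + a₁) * (A + a₂) ∧
    B * (B - b₃) = (B - b₁) * (B - b₂) ∧
    A * (a₃ - a₂ - a₁) = a₁ * a₂ ∧
    a₁ + a₂ + 1 ≤ a₃ ∧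
    4 * A < a₃ ^ 2 ∧
    (∀ C : ℤ, a₃ ≤ C → 4 * A ≤ C ^ 2) := by
  have e₁ : b₁ * (A + a₁) = B * a₁ := by linear_combination h1 - hn
  have e₂ : b₂ * (A + a₂) = B * a₂ := by linear_combination h2 - hn
  have e₃ : b₃ * (A + a₃) = B * a₃ := by linear_combination h3 - hn
  have skew : a₃ * b₁ - a₁ * b₃ = a₃ * b₂ - a₂ * b₃ := by rw [← hD31, ← hD32, heq]
  have key : A * (a₃ - a₂ - a₁) = a₁ * a₂ := by
    have hne : a₃ * B * (a₂ - a₁) ≠ 0 :=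
      mul_ne_zero (mul_ne_zero (by omega) (by omega)) (by omega)
    apply mul_left_cancel₀ hne
    linear_combination
      -(A + a₁) * (A + a₂) * (A + a₃) * skew + a₃ * (A + a₂) * (A + a₃) * e₁
        - a₃ * (A + a₁) * (A + a₃) * e₂ + (a₂ - a₁) * (A + a₁) * (A + a₂) * e₃
  have hA : A * (A + a₃) = (A + a₁) * (A + a₂) := by linear_combination key
  have hB : B * (B - b₃) = (B - b₁) * (B - b₂) := by
    have hne : A * (A + a₃) ≠ 0 := mul_ne_zero (by omega) (by omega)
    apply mul_left_cancel₀ hne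
    calc A * (A + a₃) * (B * (B - b₃)) = (A * B) * ((A + a₃) * (B - b₃)) := by ring
      _ = ((A + a₁) * (B - b₁)) * ((A + a₂) * (B - b₂)) := by rw [← hn, ← h1, ← h2, ← h3]
      _ = A * (A + a₃) * ((B - b₁) * (B - b₂)) := by rw [hA]; ring
  have hgap : 0 < a₃ - a₂ - a₁ := by
    have hpos : 0 < A * (a₃ - a₂ - a₁) := key ▸ mul_pos ha₁ (ha₁.trans ha12)
    exact pos_of_mul_pos_right hpos hApos.le
  have hlt : 4 * A < a₃ ^ 2 := by
    have hle : A ≤ a₁ * a₂ := key ▸ le_mul_of_one_le_right hApos.le hgap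
    have hsq : (a₁ + a₂) ^ 2 < a₃ ^ 2 := pow_lt_pow_left₀ (by omega) (by omega) two_ne_zero
    linarith [sq_nonneg (a₁ - a₂)]
  refine ⟨hA, hB, key, by omega, hlt, fun C hC => hlt.le.trans ?_⟩
  exact pow_le_pow_left₀ (by omega) hC 2
end

section
/- Let K, M, τ be integers and let p be a prime. Suppose p divides K but p² does not divide K (write K = p·K'), p divides τ (write τ = p·τ'), p does not divide M, and there is no integer z with K'·z² ≡ τ' (mod p) (i.e., (K')⁻¹·τ' is a quadratic non-residue modulo p). Then there are no integers x, y with K·x² − M·y² = τ. -/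
/-- Non-solvability criterion for `K·x² − M·y² = τ`: if `K = p·K'` with `p ∤ K'`,
`τ = p·τ'`, `p ∤ M`, and `K'·z² ≡ τ' (mod p)` has no solution, then no integer
solution `(x, y)` exists. -/
theorem pell_nonsolvable_nonresidue
    (K M τ K' τ' : ℤ) (p : ℕ) (hp : p.Prime)
    (hK : K = (p : ℤ) * K') (hK' : ¬ (p : ℤ) ∣ K')
    (hτ : τ = (p : ℤ) * τ')
    (hM : ¬ (p : ℤ) ∣ M)
    (hnr : ¬ ∃ z : ℤ, K' * z ^ 2 ≡ τ' [ZMOD (p : ℤ)]) :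
    ¬ ∃ x y : ℤ, K * x ^ 2 - M * y ^ 2 = τ := by
  rintro ⟨x, y, h⟩
  subst hK hτ
  have hp' : Prime (p : ℤ) := Nat.prime_iff_prime_int.mp hp
  have hdvd : (p : ℤ) ∣ M * y ^ 2 := ⟨K' * x ^ 2 - τ', by linear_combination -h⟩
  obtain ⟨w, rfl⟩ := hp'.dvd_of_dvd_pow ((hp'.dvd_or_dvd hdvd).resolve_left hM)
  refine hnr ⟨x, Int.modEq_iff_dvd.mpr ⟨-(M * w ^ 2), ?_⟩⟩
  apply mul_left_cancel₀ hp'.ne_zero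
  linear_combination -h
end

section
/- In the four close factorizations setup, let d_a := gcd(a₁, a₂) and d_b := gcd(b₁, b₂). Then there exist positive integers k and m such that b₁·k = d_b·D₃₁·(a₃ − a₂), b₂·k = d_b·D₃₂·(a₃ − a₁), a₁·m = d_a·D₃₁·(b₃ − b₂), and a₂·m = d_a·D₃₂·(b₃ − b₁). -/
/-- A proportion `q * X = p * Y` between positive integers descends along division of `p` and `q`
by their gcd. -/
theorem exists_pos_mul_eq_gcd_mul {p q X Y : ℤ} (hp : 0 < p) (hX : 0 < X)
    (h : q * X = p * Y) :
    ∃ k : ℤ, 0 < k ∧ p * k = Int.gcd p q * X ∧ q * k = Int.gcd p q * Y := by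
  have hdvd : p ∣ Int.gcd p q * X := by
    rw [Int.gcd_eq_gcd_ab]
    exact ⟨X * Int.gcdA p q + Y * Int.gcdB p q, by linear_combination Int.gcdB p q * h⟩
  obtain ⟨k, hk⟩ := hdvd
  have hg : (0 : ℤ) < Int.gcd p q := by exact_mod_cast Int.gcd_pos_of_ne_zero_left q hp.ne'
  refine ⟨k, pos_of_mul_pos_right (hk ▸ mul_pos hg hX) hp.le, hk.symm, ?_⟩
  apply mul_left_cancel₀ hp.ne'
  linear_combination (Int.gcd p q : ℤ) * h - q * hk

/-- In the four close factorizations setup, with `d_a = gcd(a₁, a₂)` and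
`d_b = gcd(b₁, b₂)`, there exist positive integers `k, m` with
`b₁·k = d_b·D₃₁·(a₃ − a₂)`, `b₂·k = d_b·D₃₂·(a₃ − a₁)`,
`a₁·m = d_a·D₃₁·(b₃ − b₂)`, and `a₂·m = d_a·D₃₂·(b₃ − b₁)`. -/
theorem four_close_factorizations_km_exist
    (n A B a₁ a₂ a₃ b₁ b₂ b₃ D₂₁ D₃₁ D₃₂ da db : ℤ)
    (hApos : 0 < A) (hBpos : 0 < B) (hBA : B ≤ A)
    (ha₁ : 0 < a₁) (ha12 : a₁ < a₂) (ha23 : a₂ < a₃)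
    (hb₁ : 0 < b₁) (hb12 : b₁ < b₂) (hb23 : b₂ < b₃)
    (hb₃B : b₃ < B)
    (hn : n = A * B)
    (h1 : n = (A + a₁) * (B - b₁))
    (h2 : n = (A + a₂) * (B - b₂))
    (h3 : n = (A + a₃) * (B - b₃))
    (hD21 : D₂₁ = a₂ * b₁ - a₁ * b₂)
    (hD31 : D₃₁ = a₃ * b₁ - a₁ * b₃)
    (hD32 : D₃₂ = a₃ * b₂ - a₂ * b₃)
    (hda : da = Int.gcd a₁ a₂) (hdb : db = Int.gcd b₁ b₂) :
    ∃ k m : ℤ, 0 < k ∧ 0 < m ∧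
      b₁ * k = db * D₃₁ * (a₃ - a₂) ∧
      b₂ * k = db * D₃₂ * (a₃ - a₁) ∧
      a₁ * m = da * D₃₁ * (b₃ - b₂) ∧
      a₂ * m = da * D₃₂ * (b₃ - b₁) := by
  have e1 : a₁ * B - b₁ * A = a₁ * b₁ := by linear_combination hn - h1
  have e2 : a₂ * B - b₂ * A = a₂ * b₂ := by linear_combination hn - h2
  have e3 : a₃ * B - b₃ * A = a₃ * b₃ := by linear_combination hn - h3
  have hdet : a₁ * b₁ * D₃₂ - a₂ * b₂ * D₃₁ + a₃ * b₃ * D₂₁ = 0 := by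
    subst hD21 hD31 hD32
    linear_combination (a₂ * b₃ - a₃ * b₂) * e1 + (a₃ * b₁ - a₁ * b₃) * e2 +
      (a₁ * b₂ - a₂ * b₁) * e3
  have hb : b₂ * (D₃₁ * (a₃ - a₂)) = b₁ * (D₃₂ * (a₃ - a₁)) := by
    subst hD21 hD31 hD32
    linear_combination hdet
  have ha : a₂ * (D₃₁ * (b₃ - b₂)) = a₁ * (D₃₂ * (b₃ - b₁)) := by
    subst hD21 hD31 hD32
    linear_combination hdet
  have ha₃ : 0 < a₃ := by linarith
  have hb₃ : 0 < b₃ := by linarith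
  have hD31pos : 0 < D₃₁ := by
    have hscaled : D₃₁ * (A + a₁) = a₁ * b₃ * (a₃ - a₁) := by
      subst hD31
      linear_combination a₁ * e3 - a₃ * e1
    have hrhs : 0 < a₁ * b₃ * (a₃ - a₁) := mul_pos (mul_pos ha₁ hb₃) (by linarith)
    exact pos_of_mul_pos_left (hscaled ▸ hrhs) (by linarith)
  obtain ⟨k, hk, hk1, hk2⟩ :=
    exists_pos_mul_eq_gcd_mul hb₁ (mul_pos hD31pos (sub_pos.2 ha23)) hb
  obtain ⟨m, hm, hm1, hm2⟩ :=
    exists_pos_mul_eq_gcd_mul ha₁ (mul_pos hD31pos (sub_pos.2 hb23)) ha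
  subst hda hdb
  exact ⟨k, m, hk, hm, by rw [hk1, mul_assoc], by rw [hk2, mul_assoc], by rw [hm1, mul_assoc],
    by rw [hm2, mul_assoc]⟩
end

section
/- In the four close factorizations setup, let d_a := gcd(a₁, a₂), d_b := gcd(b₁, b₂), and let k, m be positive integers satisfying b₁·k = d_b·D₃₁·(a₃ − a₂), b₂·k = d_b·D₃₂·(a₃ − a₁), a₁·m = d_a·D₃₁·(b₃ − b₂), a₂·m = d_a·D₃₂·(b₃ − b₁). Then D₂₁·k·m = d_a·d_b·D₃₁·D₃₂·(D₃₂ + D₂₁ − D₃₁), and d_a·k > d_b·m. -/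
/-- In the four close factorizations setup, if positive integers `k, m` satisfy the
four divisibility equations, then `D₂₁·k·m = d_a·d_b·D₃₁·D₃₂·(D₃₂ + D₂₁ − D₃₁)` and
`d_a·k > d_b·m`. -/
theorem four_close_factorizations_km_product
    (n A B a₁ a₂ a₃ b₁ b₂ b₃ D₂₁ D₃₁ D₃₂ da db k m : ℤ)
    (hApos : 0 < A) (hBpos : 0 < B) (hBA : B ≤ A)
    (ha₁ : 0 < a₁) (ha12 : a₁ < a₂) (ha23 : a₂ < a₃)
    (hb₁ : 0 < b₁) (hb12 : b₁ < b₂) (hb23 : b₂ < b₃)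
    (hb₃B : b₃ < B)
    (hn : n = A * B)
    (h1 : n = (A + a₁) * (B - b₁))
    (h2 : n = (A + a₂) * (B - b₂))
    (h3 : n = (A + a₃) * (B - b₃))
    (hD21 : D₂₁ = a₂ * b₁ - a₁ * b₂)
    (hD31 : D₃₁ = a₃ * b₁ - a₁ * b₃)
    (hD32 : D₃₂ = a₃ * b₂ - a₂ * b₃)
    (hda : da = Int.gcd a₁ a₂) (hdb : db = Int.gcd b₁ b₂)
    (hk : 0 < k) (hm : 0 < m)
    (hk1 : b₁ * k = db * D₃₁ * (a₃ - a₂))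
    (hk2 : b₂ * k = db * D₃₂ * (a₃ - a₁))
    (hm1 : a₁ * m = da * D₃₁ * (b₃ - b₂))
    (hm2 : a₂ * m = da * D₃₂ * (b₃ - b₁)) :
    D₂₁ * k * m = da * db * D₃₁ * D₃₂ * (D₃₂ + D₂₁ - D₃₁) ∧ da * k > db * m := by
  constructor
  · subst hD21
    have h : (a₂ * b₁ - a₁ * b₂) * k * m
        = da * db * D₃₁ * D₃₂ * ((a₃ - a₂) * (b₃ - b₁) - (a₃ - a₁) * (b₃ - b₂)) := by
      linear_combination (a₂ * m) * hk1 + (db * D₃₁ * (a₃ - a₂)) * hm2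
        - (a₁ * m) * hk2 - (db * D₃₂ * (a₃ - a₁)) * hm1
    rw [h, show (a₃ - a₂) * (b₃ - b₁) - (a₃ - a₁) * (b₃ - b₂)
      = D₃₂ + (a₂ * b₁ - a₁ * b₂) - D₃₁ by rw [hD31, hD32]; ring]
  · have hda0 : 0 < da := by
      rw [hda]; exact_mod_cast Int.gcd_pos_of_ne_zero_left _ ha₁.ne'
    have hP : 0 < db * D₃₁ :=
      pos_of_mul_pos_left (hk1 ▸ mul_pos hb₁ hk) (sub_pos.2 ha23).le
    have hab₁ : b₁ < a₁ := by
      have e : a₁ * (B - b₁) = A * b₁ := by linarith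
      by_contra! h
      nlinarith [mul_le_mul_of_nonneg_right h (by linarith : 0 ≤ B - b₁),
        mul_pos hb₁ (by linarith : 0 < A - (B - b₁))]
    have hab₃₂ : b₃ - b₂ < a₃ - a₂ := by
      have e : (a₃ - a₂) * (B - b₃) = (A + a₂) * (b₃ - b₂) := by linarith
      by_contra! h
      nlinarith [mul_le_mul_of_nonneg_right h (by linarith : 0 ≤ B - b₃),
        mul_pos (sub_pos.2 hb23) (by linarith : 0 < A + a₂ - (B - b₃))]
    have hlt : (b₃ - b₂) * b₁ < (a₃ - a₂) * a₁ :=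
      mul_lt_mul hab₃₂ hab₁.le hb₁ (by linarith)
    have key : (a₁ * b₁) * (db * m) < (a₁ * b₁) * (da * k) := by
      calc (a₁ * b₁) * (db * m) = da * (db * D₃₁) * ((b₃ - b₂) * b₁) := by
            linear_combination (b₁ * db) * hm1
        _ < da * (db * D₃₁) * ((a₃ - a₂) * a₁) :=
            mul_lt_mul_of_pos_left hlt (mul_pos hda0 hP)
        _ = (a₁ * b₁) * (da * k) := by linear_combination -(a₁ * da) * hk1
    exact lt_of_mul_lt_mul_left key (mul_pos ha₁ hb₁).le
end

section
/- In the four close factorizations setup, let d_a := gcd(a₁, a₂), d_b := gcd(b₁, b₂), and let k, m be positive integers satisfying b₁·k = d_b·D₃₁·(a₃ − a₂), b₂·k = d_b·D₃₂·(a₃ − a₁), a₁·m = d_a·D₃₁·(b₃ − b₂), a₂·m = d_a·D₃₂·(b₃ − b₁). Then d_a·k·b₁² − d_b·m·a₁² = d_a·d_b·D₃₁·(D₃₁ − D₂₁) (the generalized Pell equation), and d_b·(D₃₁ − D₂₁)·a₃ = k·b₁ + d_b·D₃₂·a₁. -/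
/-- In the four close factorizations setup, if positive integers `k, m` satisfy the
four divisibility equations, then the generalized Pell equation
`d_a·k·b₁² − d_b·m·a₁² = d_a·d_b·D₃₁·(D₃₁ − D₂₁)` holds, together with
`d_b·(D₃₁ − D₂₁)·a₃ = k·b₁ + d_b·D₃₂·a₁`. -/
theorem four_close_factorizations_pell_equation
    (n A B a₁ a₂ a₃ b₁ b₂ b₃ D₂₁ D₃₁ D₃₂ da db k m : ℤ)
    (hApos : 0 < A) (hBpos : 0 < B) (hBA : B ≤ A)
    (ha₁ : 0 < a₁) (ha12 : a₁ < a₂) (ha23 : a₂ < a₃)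
    (hb₁ : 0 < b₁) (hb12 : b₁ < b₂) (hb23 : b₂ < b₃)
    (hb₃B : b₃ < B)
    (hn : n = A * B)
    (h1 : n = (A + a₁) * (B - b₁))
    (h2 : n = (A + a₂) * (B - b₂))
    (h3 : n = (A + a₃) * (B - b₃))
    (hD21 : D₂₁ = a₂ * b₁ - a₁ * b₂)
    (hD31 : D₃₁ = a₃ * b₁ - a₁ * b₃)
    (hD32 : D₃₂ = a₃ * b₂ - a₂ * b₃)
    (hda : da = Int.gcd a₁ a₂) (hdb : db = Int.gcd b₁ b₂)
    (hk : 0 < k) (hm : 0 < m)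
    (hk1 : b₁ * k = db * D₃₁ * (a₃ - a₂))
    (hk2 : b₂ * k = db * D₃₂ * (a₃ - a₁))
    (hm1 : a₁ * m = da * D₃₁ * (b₃ - b₂))
    (hm2 : a₂ * m = da * D₃₂ * (b₃ - b₁)) :
    da * k * b₁ ^ 2 - db * m * a₁ ^ 2 = da * db * D₃₁ * (D₃₁ - D₂₁) ∧
    db * (D₃₁ - D₂₁) * a₃ = k * b₁ + db * D₃₂ * a₁ := by
  constructor
  · subst hD21 hD31
    linear_combination da * b₁ * hk1 - db * a₁ * hm1
  · subst hD21 hD31 hD32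
    linear_combination -hk1
end

section
/- In the four close factorizations setup, suppose D₂₁ = 1, i.e., a₂·b₁ − a₁·b₂ = 1. Then there exist positive integers k and m with k > m such that b₁·k = D₃₁·(a₃ − a₂), b₂·k = D₃₂·(a₃ − a₁), a₁·m = D₃₁·(b₃ − b₂), a₂·m = D₃₂·(b₃ − b₁), k·m = D₃₁·D₃₂·(D₃₂ − D₃₁ + 1), and k·b₁² − m·a₁² = D₃₁·(D₃₁ − 1). -/
/-- In the four close factorizations setup with `D₂₁ = 1`, there exist positive
integers `k > m` with `b₁·k = D₃₁·(a₃ − a₂)`, `b₂·k = D₃₂·(a₃ − a₁)`,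
`a₁·m = D₃₁·(b₃ − b₂)`, `a₂·m = D₃₂·(b₃ − b₁)`,
`k·m = D₃₁·D₃₂·(D₃₂ − D₃₁ + 1)`, and `k·b₁² − m·a₁² = D₃₁·(D₃₁ − 1)`. -/
theorem four_close_factorizations_D21_one
    (n A B a₁ a₂ a₃ b₁ b₂ b₃ D₂₁ D₃₁ D₃₂ : ℤ)
    (hApos : 0 < A) (hBpos : 0 < B) (hBA : B ≤ A)
    (ha₁ : 0 < a₁) (ha12 : a₁ < a₂) (ha23 : a₂ < a₃)
    (hb₁ : 0 < b₁) (hb12 : b₁ < b₂) (hb23 : b₂ < b₃)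
    (hb₃B : b₃ < B)
    (hn : n = A * B)
    (h1 : n = (A + a₁) * (B - b₁))
    (h2 : n = (A + a₂) * (B - b₂))
    (h3 : n = (A + a₃) * (B - b₃))
    (hD21 : D₂₁ = a₂ * b₁ - a₁ * b₂)
    (hD31 : D₃₁ = a₃ * b₁ - a₁ * b₃)
    (hD32 : D₃₂ = a₃ * b₂ - a₂ * b₃)
    (hone : D₂₁ = 1) :
    ∃ k m : ℤ, 0 < m ∧ m < k ∧
      b₁ * k = D₃₁ * (a₃ - a₂) ∧
      b₂ * k = D₃₂ * (a₃ - a₁) ∧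
      a₁ * m = D₃₁ * (b₃ - b₂) ∧
      a₂ * m = D₃₂ * (b₃ - b₁) ∧
      k * m = D₃₁ * D₃₂ * (D₃₂ - D₃₁ + 1) ∧
      k * b₁ ^ 2 - m * a₁ ^ 2 = D₃₁ * (D₃₁ - 1) := by
  have e1 : a₁ * B - A * b₁ = a₁ * b₁ := by linarith
  have e2 : a₂ * B - A * b₂ = a₂ * b₂ := by linarith
  have e3 : a₃ * B - A * b₃ = a₃ * b₃ := by linarith
  have hdet : a₂ * b₁ - a₁ * b₂ = 1 := hD21.symm.trans hone
  have hb₃ : 0 < b₃ := by linarith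
  have ha₃ : 0 < a₃ := by linarith
  have xB : D₃₁ * B = b₁ * b₃ * (a₃ - a₁) := by
    rw [hD31]; linear_combination b₁ * e3 - b₃ * e1
  have yB : D₃₂ * B = b₂ * b₃ * (a₃ - a₂) := by
    rw [hD32]; linear_combination b₂ * e3 - b₃ * e2
  have xA : D₃₁ * A = a₁ * a₃ * (b₃ - b₁) := by
    rw [hD31]; linear_combination a₁ * e3 - a₃ * e1
  have yA : D₃₂ * A = a₂ * a₃ * (b₃ - b₂) := by
    rw [hD32]; linear_combination a₂ * e3 - a₃ * e2
  have hx : 0 < D₃₁ := by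
    refine pos_of_mul_pos_left (b := B) ?_ hBpos.le
    rw [xB]
    exact mul_pos (mul_pos hb₁ hb₃) (by linarith)
  have hk : b₂ * (D₃₁ * (a₃ - a₂)) = b₁ * (D₃₂ * (a₃ - a₁)) :=
    mul_left_cancel₀ hb₃.ne' (by linear_combination D₃₂ * xB - D₃₁ * yB)
  have hm : a₂ * (D₃₁ * (b₃ - b₂)) = a₁ * (D₃₂ * (b₃ - b₁)) :=
    mul_left_cancel₀ ha₃.ne' (by linear_combination D₃₂ * xA - D₃₁ * yA)
  obtain ⟨k, hkdef⟩ : ∃ k, k = a₂ * (D₃₁ * (a₃ - a₂)) - a₁ * (D₃₂ * (a₃ - a₁)) := ⟨_, rfl⟩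
  obtain ⟨m, hmdef⟩ : ∃ m, m = b₁ * (D₃₂ * (b₃ - b₁)) - b₂ * (D₃₁ * (b₃ - b₂)) := ⟨_, rfl⟩
  have k1 : b₁ * k = D₃₁ * (a₃ - a₂) := by
    linear_combination b₁ * hkdef + D₃₁ * (a₃ - a₂) * hdet + a₁ * hk
  have k2 : b₂ * k = D₃₂ * (a₃ - a₁) := by
    linear_combination b₂ * hkdef + D₃₂ * (a₃ - a₁) * hdet + a₂ * hk
  have m1 : a₁ * m = D₃₁ * (b₃ - b₂) := by
    linear_combination a₁ * hmdef + D₃₁ * (b₃ - b₂) * hdet - b₁ * hm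
  have m2 : a₂ * m = D₃₂ * (b₃ - b₁) := by
    linear_combination a₂ * hmdef + D₃₂ * (b₃ - b₁) * hdet - b₂ * hm
  have hab₁ : b₁ < a₁ := by
    by_contra! h
    nlinarith [mul_le_mul h hBA hBpos.le hb₁.le, mul_pos ha₁ hb₁]
  have hab₃₂ : b₃ - b₂ < a₃ - a₂ := by
    by_contra! h
    nlinarith [mul_le_mul h hBA hBpos.le (by linarith : 0 ≤ b₃ - b₂),
      mul_lt_mul'' ha23 hb23 (by linarith) (by linarith)]
  refine ⟨k, m, ?_, ?_, k1, k2, m1, m2, ?_, ?_⟩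
  · refine pos_of_mul_pos_right (a := a₁) ?_ ha₁.le
    rw [m1]
    exact mul_pos hx (by linarith)
  · have hlt : b₁ * (b₃ - b₂) < a₁ * (a₃ - a₂) :=
      mul_lt_mul'' hab₁ hab₃₂ hb₁.le (by linarith)
    refine lt_of_mul_lt_mul_left (a := a₁ * b₁) ?_ (by positivity)
    calc a₁ * b₁ * m = D₃₁ * (b₁ * (b₃ - b₂)) := by linear_combination b₁ * m1
      _ < D₃₁ * (a₁ * (a₃ - a₂)) := mul_lt_mul_of_pos_left hlt hx
      _ = a₁ * b₁ * k := by linear_combination -a₁ * k1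
  · linear_combination (-k * m) * hdet + a₂ * m * k1 + D₃₁ * (a₃ - a₂) * m2
      - a₁ * m * k2 - D₃₂ * (a₃ - a₁) * m1
      + D₃₁ * D₃₂ * (hdet + hD31 - hD32)
  · linear_combination b₁ * k1 - a₁ * m1 - D₃₁ * (hdet + hD31)
end

section
/- There exists a constant c > 0 such that the following holds for every four close factorizations setup with skews satisfying 1 ≤ D₂₁ ≤ 5, 1 ≤ D₃₁ ≤ 5, 1 ≤ D₃₂ ≤ 5. Let d_a := gcd(a₁, a₂), d_b := gcd(b₁, b₂), α₁ := a₁/d_a, and let k, m be positive integers satisfying b₁·k = d_b·D₃₁·(a₃ − a₂), b₂·k = d_b·D₃₂·(a₃ − a₁), a₁·m = d_a·D₃₁·(b₃ − b₂), a₂·m = d_a·D₃₂·(b₃ − b₁). Then, as real numbers, | A/a₃³ − m·(D₃₁ − D₂₁)·(D₂₁·√(k·m/(d_a·d_b)) + D₃₂·D₃₁)·(D₂₁ + D₃₁·√(d_a·d_b/(k·m))·(D₃₂ − D₃₁ + D₂₁)) / (D₂₁·D₃₁²·d_a·(√(k·m/(d_a·d_b)) + D₃₂)³) | ≤ c/α₁².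 -/
/-- The skews of three points on the hyperbola `x * B - y * A = x * y` determine the product
of the differences of the last two points in terms of the first one. -/
lemma skew_mul_differences {A B a₁ a₂ a₃ b₁ b₂ b₃ D₂₁ D₃₁ D₃₂ : ℝ}
    (h₁ : a₁ * B - b₁ * A = a₁ * b₁) (h₂ : a₂ * B - b₂ * A = a₂ * b₂)
    (h₃ : a₃ * B - b₃ * A = a₃ * b₃)
    (hD₂₁ : D₂₁ = a₂ * b₁ - a₁ * b₂) (hD₃₁ : D₃₁ = a₃ * b₁ - a₁ * b₃)
    (hD₃₂ : D₃₂ = a₃ * b₂ - a₂ * b₃) :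
    D₂₁ * D₃₁ * ((a₃ - a₂) * (b₃ - b₂)) = D₃₂ * (D₃₂ - D₃₁ + D₂₁) * (a₁ * b₁) := by
  have hlin : D₃₂ * (a₁ * b₁) - D₃₁ * (a₂ * b₂) + D₂₁ * (a₃ * b₃) = 0 := by
    rw [← h₁, ← h₂, ← h₃, hD₂₁, hD₃₁, hD₃₂]
    ring
  have hquad : D₃₂ ^ 2 * (a₁ * b₁) = D₃₁ ^ 2 * (a₂ * b₂) + D₂₁ ^ 2 * (a₃ * b₃)
      - D₂₁ * D₃₁ * (a₂ * b₃ + a₃ * b₂) := by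
    rw [hD₂₁, hD₃₁, hD₃₂]
    ring
  linear_combination (D₃₁ - D₂₁) * hlin - hquad

/-- The function `u ↦ (p * u + q) / (r * u ^ 2)` is decreasing and Lipschitz away from zero. -/
lemma abs_div_sq_sub_div_sq_le {p q r u v : ℝ} (hp : 0 ≤ p) (hp5 : p ≤ 5) (hq : 0 ≤ q)
    (hq5 : q ≤ 5) (hr : 1 ≤ r) (hv : 1 / 4 ≤ v) (huv : v ≤ u) :
    |(p * u + q) / (r * u ^ 2) - (p * v + q) / (r * v ^ 2)| ≤ 720 * (u - v) := by
  have hv0 : 0 < v := by linarith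
  have hu0 : 0 < u := by linarith
  have hr0 : 0 < r := by linarith
  have hiv : v⁻¹ ≤ 4 := by
    rw [inv_le_comm₀ hv0 (by norm_num)]
    linarith
  have hiu : u⁻¹ ≤ 4 := (inv_anti₀ hv0 huv).trans hiv
  have hir : r⁻¹ ≤ 1 := inv_le_one_of_one_le₀ hr
  have hiv0 : 0 ≤ v⁻¹ := by positivity
  have hiu0 : 0 ≤ u⁻¹ := by positivity
  have hir0 : 0 ≤ r⁻¹ := by positivity
  have heq : (p * u + q) / (r * u ^ 2) - (p * v + q) / (r * v ^ 2)
      = -((u - v) * (r⁻¹ * (p * (u⁻¹ * v⁻¹) + q * (u⁻¹ * v⁻¹ * (u⁻¹ + v⁻¹))))) := by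
    field_simp
    ring
  have hprod : u⁻¹ * v⁻¹ ≤ 4 * 4 := by gcongr
  have hbr : r⁻¹ * (p * (u⁻¹ * v⁻¹) + q * (u⁻¹ * v⁻¹ * (u⁻¹ + v⁻¹)))
      ≤ 1 * (5 * (4 * 4) + 5 * (4 * 4 * (4 + 4))) := by gcongr
  rw [heq, abs_neg, abs_of_nonneg (mul_nonneg (by linarith) (by positivity))]
  nlinarith

/-- If `K * t` and `M / t` are close, then both are close to their geometric mean. -/
lemma mul_sub_geometric_mean_le {K M s a b e : ℝ} (hM : 0 < M) (hs : 0 < s)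
    (ha : 0 < a) (hb : 0 < b) (he : 0 ≤ e) (hs2 : s ^ 2 = K * M)
    (hKM : K * b ^ 2 - M * a ^ 2 = e) :
    s ≤ K * b / a ∧ M * (K * b / a - s) ≤ s * e / a ^ 2 := by
  have hsq : (M * a) ^ 2 ≤ (s * b) ^ 2 := by nlinarith
  have hle : M * a ≤ s * b := (sq_le_sq₀ (by positivity) (by positivity)).1 hsq
  have hKs : s * a ≤ K * b := by
    refine le_of_mul_le_mul_left (a := M) ?_ hM
    nlinarith
  refine ⟨(le_div_iff₀ ha).2 hKs, ?_⟩
  have hdiff : M * (K * b - s * a) * b ≤ M * e := by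
    nlinarith [mul_le_mul_of_nonneg_left hle (mul_nonneg hM.le ha.le)]
  have hfin : M * (K * b - s * a) * a ≤ s * e := by
    refine le_of_mul_le_mul_left (a := b) ?_ hb
    nlinarith [mul_le_mul_of_nonneg_right hle he]
  rw [le_div_iff₀ (by positivity)]
  calc M * (K * b / a - s) * a ^ 2 = M * (K * b - s * a) * a := by field_simp
    _ ≤ s * e := hfin

/-- The ratio formula over the reals, with `K` and `M` the quotients `k / d_b` and `m / d_a`
and `s` the geometric mean of `K` and `M`. -/
lemma abs_ratio_sub_le {A B a₁ a₂ a₃ b₁ b₂ b₃ D₂₁ D₃₁ D₃₂ K M s : ℝ}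
    (ha₁ : 0 < a₁) (ha₃ : 0 < a₃) (hb₁ : 0 < b₁)
    (h₁ : a₁ * B - b₁ * A = a₁ * b₁) (h₂ : a₂ * B - b₂ * A = a₂ * b₂)
    (h₃ : a₃ * B - b₃ * A = a₃ * b₃)
    (hD₂₁ : D₂₁ = a₂ * b₁ - a₁ * b₂) (hD₃₁ : D₃₁ = a₃ * b₁ - a₁ * b₃)
    (hD₃₂ : D₃₂ = a₃ * b₂ - a₂ * b₃)
    (hl₂₁ : 1 ≤ D₂₁) (hu₂₁ : D₂₁ ≤ 5) (hl₃₁ : 1 ≤ D₃₁) (hu₃₁ : D₃₁ ≤ 5)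
    (hl₃₂ : 1 ≤ D₃₂) (hu₃₂ : D₃₂ ≤ 5) (hK : 0 < K) (hM : 0 < M) (hs : 0 < s)
    (hs2 : s ^ 2 = K * M)
    (hKb : b₁ * K = D₃₁ * (a₃ - a₂)) (hMa₁ : a₁ * M = D₃₁ * (b₃ - b₂))
    (hMa₂ : a₂ * M = D₃₂ * (b₃ - b₁)) :
    |A / a₃ ^ 3 - M * (D₃₁ - D₂₁) * (D₂₁ * s + D₃₂ * D₃₁) *
      (D₂₁ + D₃₁ * s⁻¹ * (D₃₂ - D₃₁ + D₂₁)) / (D₂₁ * D₃₁ ^ 2 * (s + D₃₂) ^ 3)|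
      ≤ 54000 / a₁ ^ 2 := by
  have hs21 : s ^ 2 * D₂₁ = D₃₁ * D₃₂ * (D₃₂ - D₃₁ + D₂₁) := by
    have h := skew_mul_differences h₁ h₂ h₃ hD₂₁ hD₃₁ hD₃₂
    refine mul_left_cancel₀ (a := a₁ * b₁) (by positivity) ?_
    rw [hs2]
    linear_combination D₂₁ * a₁ * M * hKb + D₂₁ * D₃₁ * (a₃ - a₂) * hMa₁ + D₃₁ * h
  have hW : D₃₂ - D₃₁ + D₂₁ ≤ 9 := by linarith
  have hs15 : s ≤ 15 := by
    have h25 : D₃₁ * D₃₂ ≤ 5 * 5 := by gcongr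
    have h0 : 0 < D₃₁ * D₃₂ := by positivity
    have h15 : s ^ 2 ≤ 15 ^ 2 := by nlinarith
    exact (sq_le_sq₀ hs.le (by norm_num)).1 h15
  have hEa : (D₃₁ - D₂₁) * a₃ = D₃₂ * a₁ + K * b₁ := by
    rw [mul_comm K, hKb, hD₂₁, hD₃₁, hD₃₂]
    ring
  have hEb : (D₃₁ - D₂₁) * b₃ = D₃₂ * b₁ + M * a₁ := by
    rw [mul_comm M, hMa₁, hD₂₁, hD₃₁, hD₃₂]
    ring
  have hE : 0 < D₃₁ - D₂₁ := by
    refine pos_of_mul_pos_left (b := a₃) ?_ ha₃.le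
    rw [hEa]
    positivity
  have hKM : K * b₁ ^ 2 - M * a₁ ^ 2 = (D₃₁ - D₂₁) * D₃₁ := by
    linear_combination (-b₁) * hEa + a₁ * hEb - (D₃₁ - D₂₁) * hD₃₁
  obtain ⟨hst, hMst⟩ := mul_sub_geometric_mean_le hM hs ha₁ hb₁
    (mul_nonneg hE.le (by linarith)) hs2 hKM
  set u := a₃ / a₁ with hu
  set v := (s + D₃₂) / (D₃₁ - D₂₁) with hv
  have huv : u - v = (K * b₁ / a₁ - s) / (D₃₁ - D₂₁) := by
    rw [hu, hv]
    field_simp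
    linear_combination hEa
  have hvu : v ≤ u := by
    have : 0 ≤ u - v := huv ▸ div_nonneg (by linarith) hE.le
    linarith
  have hv4 : 1 / 4 ≤ v := by
    rw [hv, le_div_iff₀ hE]
    linarith
  have hMuv : M * (u - v) ≤ 75 / a₁ ^ 2 := by
    rw [huv, ← mul_div_assoc, div_le_iff₀ hE]
    refine hMst.trans ?_
    rw [div_mul_eq_mul_div]
    refine div_le_div_of_nonneg_right ?_ (by positivity)
    have h75 : s * D₃₁ ≤ 15 * 5 := by gcongr
    nlinarith
  have hA : A / a₃ ^ 3 = M / (D₃₁ * D₃₂) * ((D₂₁ * u + D₃₂) / (D₃₁ * u ^ 2)) := by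
    have hAD : A * D₃₁ = a₁ * a₃ * (b₃ - b₁) := by
      rw [hD₃₁]
      linear_combination (-a₃) * h₁ + a₁ * h₃
    have hx : D₂₁ * a₃ + D₃₂ * a₁ = D₃₁ * a₂ := by
      rw [hD₂₁, hD₃₁, hD₃₂]
      ring
    have hx' : (D₂₁ * u + D₃₂) / (D₃₁ * u ^ 2) = a₁ * a₂ / a₃ ^ 2 := by
      rw [hu]
      field_simp
      linear_combination hx
    rw [hx']
    field_simp
    linear_combination D₃₂ * hAD - a₁ * a₃ * hMa₂
  have hT : M * (D₃₁ - D₂₁) * (D₂₁ * s + D₃₂ * D₃₁) *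
      (D₂₁ + D₃₁ * s⁻¹ * (D₃₂ - D₃₁ + D₂₁)) / (D₂₁ * D₃₁ ^ 2 * (s + D₃₂) ^ 3)
      = M / (D₃₁ * D₃₂) * ((D₂₁ * v + D₃₂) / (D₃₁ * v ^ 2)) := by
    have hfac : D₂₁ + D₃₁ * s⁻¹ * (D₃₂ - D₃₁ + D₂₁) = D₂₁ * (s + D₃₂) / D₃₂ := by
      field_simp
      linear_combination -hs21
    have hnum : D₂₁ * v + D₃₂ = (D₂₁ * s + D₃₂ * D₃₁) / (D₃₁ - D₂₁) := by
      rw [hv]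
      field_simp
      ring
    have hsD : 0 < s + D₃₂ := by linarith
    rw [hfac, hnum, hv]
    field_simp
  have hDD : 1 ≤ D₃₁ * D₃₂ := one_le_mul_of_one_le_of_one_le hl₃₁ hl₃₂
  rw [hA, hT, ← mul_sub, abs_mul, abs_of_nonneg (by positivity)]
  calc M / (D₃₁ * D₃₂) * |(D₂₁ * u + D₃₂) / (D₃₁ * u ^ 2) - (D₂₁ * v + D₃₂) / (D₃₁ * v ^ 2)|
      ≤ M * (720 * (u - v)) :=
        mul_le_mul (div_le_self hM.le hDD)
          (abs_div_sq_sub_div_sq_le (by linarith) hu₂₁ (by linarith) hu₃₂ hl₃₁ hv4 hvu)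
          (abs_nonneg _) hM.le
    _ = 720 * (M * (u - v)) := by ring
    _ ≤ 720 * (75 / a₁ ^ 2) := by gcongr
    _ = 54000 / a₁ ^ 2 := by ring

/-- Formula for the ratio `R₄ = A/a₃³` in the four close factorizations setup when all
skews are between `1` and `5`: it equals an explicit expression in the parameters
`D₂₁, D₃₁, D₃₂, d_a, d_b, k, m` up to an error `O(1/α₁²)` where `α₁ = a₁/d_a`. -/
theorem four_close_factorizations_ratio_formula :
    ∃ c : ℝ, 0 < c ∧
      ∀ n A B a₁ a₂ a₃ b₁ b₂ b₃ D₂₁ D₃₁ D₃₂ da db α₁ k m : ℤ,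
        0 < A → 0 < B → B ≤ A →
        0 < a₁ → a₁ < a₂ → a₂ < a₃ →
        0 < b₁ → b₁ < b₂ → b₂ < b₃ → b₃ < B →
        n = A * B →
        n = (A + a₁) * (B - b₁) →
        n = (A + a₂) * (B - b₂) →
        n = (A + a₃) * (B - b₃) →
        D₂₁ = a₂ * b₁ - a₁ * b₂ →
        D₃₁ = a₃ * b₁ - a₁ * b₃ →
        D₃₂ = a₃ * b₂ - a₂ * b₃ →
        1 ≤ D₂₁ → D₂₁ ≤ 5 →
        1 ≤ D₃₁ → D₃₁ ≤ 5 →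
        1 ≤ D₃₂ → D₃₂ ≤ 5 →
        da = Int.gcd a₁ a₂ → db = Int.gcd b₁ b₂ →
        a₁ = da * α₁ →
        0 < k → 0 < m →
        b₁ * k = db * D₃₁ * (a₃ - a₂) →
        b₂ * k = db * D₃₂ * (a₃ - a₁) →
        a₁ * m = da * D₃₁ * (b₃ - b₂) →
        a₂ * m = da * D₃₂ * (b₃ - b₁) →
        |(A : ℝ) / (a₃ : ℝ) ^ 3 -
          (m : ℝ) * ((D₃₁ : ℝ) - (D₂₁ : ℝ)) *
            ((D₂₁ : ℝ) * Real.sqrt ((k : ℝ) * (m : ℝ) / ((da : ℝ) * (db : ℝ)))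
              + (D₃₂ : ℝ) * (D₃₁ : ℝ)) *
            ((D₂₁ : ℝ) + (D₃₁ : ℝ) *
              Real.sqrt ((da : ℝ) * (db : ℝ) / ((k : ℝ) * (m : ℝ))) *
              ((D₃₂ : ℝ) - (D₃₁ : ℝ) + (D₂₁ : ℝ))) /
          ((D₂₁ : ℝ) * (D₃₁ : ℝ) ^ 2 * (da : ℝ) *
            (Real.sqrt ((k : ℝ) * (m : ℝ) / ((da : ℝ) * (db : ℝ))) + (D₃₂ : ℝ)) ^ 3)|
          ≤ c / (α₁ : ℝ) ^ 2 := by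
  refine ⟨54000, by norm_num, ?_⟩
  intro n A B a₁ a₂ a₃ b₁ b₂ b₃ D₂₁ D₃₁ D₃₂ da db α₁ k m hA hB hBA ha₁ ha₁₂ ha₂₃ hb₁ hb₁₂ hb₂₃
    hb₃ hn hn₁ hn₂ hn₃ hD₂₁ hD₃₁ hD₃₂ hl₂₁ hu₂₁ hl₃₁ hu₃₁ hl₃₂ hu₃₂ hda hdb hα hk hm
    hkb₁ hkb₂ hma₁ hma₂
  have hda0 : 0 < da := by
    rw [hda]
    exact_mod_cast Int.gcd_pos_of_ne_zero_left _ ha₁.ne'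
  have hdb0 : 0 < db := by
    rw [hdb]
    exact_mod_cast Int.gcd_pos_of_ne_zero_left _ hb₁.ne'
  have hα0 : 0 < α₁ := pos_of_mul_pos_right (hα ▸ ha₁) hda0.le
  have hαa : α₁ ≤ a₁ := by nlinarith
  have h₁ : a₁ * B - b₁ * A = a₁ * b₁ := by linear_combination hn - hn₁
  have h₂ : a₂ * B - b₂ * A = a₂ * b₂ := by linear_combination hn - hn₂
  have h₃ : a₃ * B - b₃ * A = a₃ * b₃ := by linear_combination hn - hn₃
  have hda' : (0 : ℝ) < da := by exact_mod_cast hda0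
  have hdb' : (0 : ℝ) < db := by exact_mod_cast hdb0
  have hk' : (0 : ℝ) < k := by exact_mod_cast hk
  have hm' : (0 : ℝ) < m := by exact_mod_cast hm
  have hα' : (0 : ℝ) < α₁ := by exact_mod_cast hα0
  have hαa' : (α₁ : ℝ) ≤ a₁ := by exact_mod_cast hαa
  have hKb : (b₁ : ℝ) * (k / db) = D₃₁ * (a₃ - a₂) := by
    have h : (b₁ : ℝ) * k = db * D₃₁ * (a₃ - a₂) := by exact_mod_cast hkb₁
    field_simp
    linear_combination h
  have hMa₁ : (a₁ : ℝ) * (m / da) = D₃₁ * (b₃ - b₂) := by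
    have h : (a₁ : ℝ) * m = da * D₃₁ * (b₃ - b₂) := by exact_mod_cast hma₁
    field_simp
    linear_combination h
  have hMa₂ : (a₂ : ℝ) * (m / da) = D₃₂ * (b₃ - b₁) := by
    have h : (a₂ : ℝ) * m = da * D₃₂ * (b₃ - b₁) := by exact_mod_cast hma₂
    field_simp
    linear_combination h
  have hinv : Real.sqrt ((da : ℝ) * db / (k * m)) = (Real.sqrt ((k : ℝ) * m / (da * db)))⁻¹ := by
    rw [← Real.sqrt_inv, inv_div]
  rw [hinv]
  set s := Real.sqrt ((k : ℝ) * m / (da * db)) with hsdef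
  have hs : 0 < s := Real.sqrt_pos.2 (by positivity)
  have hs2 : s ^ 2 = (k / db : ℝ) * (m / da) := by
    rw [hsdef, Real.sq_sqrt (by positivity)]
    field_simp
  have key := abs_ratio_sub_le (A := A) (B := B) (a₁ := a₁) (a₂ := a₂) (a₃ := a₃) (b₁ := b₁)
    (b₂ := b₂) (b₃ := b₃) (D₂₁ := D₂₁) (D₃₁ := D₃₁) (D₃₂ := D₃₂) (K := k / db) (M := m / da)
    (s := s) (by exact_mod_cast ha₁) (by exact_mod_cast (ha₁.trans ha₁₂).trans ha₂₃)
    (by exact_mod_cast hb₁) (by exact_mod_cast h₁) (by exact_mod_cast h₂) (by exact_mod_cast h₃)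
    (by exact_mod_cast hD₂₁) (by exact_mod_cast hD₃₁) (by exact_mod_cast hD₃₂)
    (by exact_mod_cast hl₂₁) (by exact_mod_cast hu₂₁) (by exact_mod_cast hl₃₁)
    (by exact_mod_cast hu₃₁) (by exact_mod_cast hl₃₂) (by exact_mod_cast hu₃₂)
    (by positivity) (by positivity) hs hs2 hKb hMa₁ hMa₂
  have hbound : (54000 : ℝ) / (a₁ : ℝ) ^ 2 ≤ 54000 / (α₁ : ℝ) ^ 2 := by gcongr
  refine le_trans (le_of_eq ?_) (key.trans hbound)
  congr 2
  simp only [div_eq_mul_inv, mul_inv]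
  ring
end
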